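/- arXiv:1509.01345 — 3 statements merged into one kernel-verified Lean document; each statement's English description precedes it below -/
import Mathlib

section
/- Let q be any prime power and let G(u) = ∏_P (1 − 3u^{2·deg(P)} + 2u^{3·deg(P)}), the product over all monic irreducible P of A = 𝔽_q[t], convergent for real 0 ≤ u < q^{−1/2}. Then for every ε > 0, as n → ∞, Σ_D 2^{ω(D)} = q^{n}·( G(q^{−1})·(n+1) − q^{−1}·G′(q^{−1}) ) + O(q^{(1/2+ε)n}), where the sum runs over all squarefree monic polynomials D ∈ A of degree n. -/
open Polynomial Filter Asymptotics Topology

noncomputable section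

/-- `ω(D)`: the number of distinct monic irreducible factors of `D`. -/
noncomputable def omegaCount (Fq : Type*) [Field Fq] (D : Polynomial Fq) : ℕ :=
  Nat.card {P : Polynomial Fq // P.Monic ∧ Irreducible P ∧ P ∣ D}

/-- the monic irreducible polynomials -/
abbrev MonIrr (Fq : Type*) [Field Fq] := {P : Polynomial Fq // P.Monic ∧ Irreducible P}

lemma finite_monic (Fq : Type*) [Field Fq] [Fintype Fq] (n : ℕ) :
    {D : Fq[X] | D.Monic ∧ D.natDegree = n}.Finite := by
  have e := (monicEquivDegreeLT (R := Fq) n).trans (degreeLTEquiv Fq n).toEquiv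
  have : Finite {D : Fq[X] // D.Monic ∧ D.natDegree = n} := Finite.of_equiv _ e.symm
  exact Set.finite_coe_iff.1 this

lemma ncard_monic (Fq : Type*) [Field Fq] [Fintype Fq] (n : ℕ) :
    {D : Fq[X] | D.Monic ∧ D.natDegree = n}.ncard = (Fintype.card Fq) ^ n := by
  have e := (monicEquivDegreeLT (R := Fq) n).trans (degreeLTEquiv Fq n).toEquiv
  rw [← Nat.card_coe_set_eq]
  refine (Nat.card_congr e).trans ?_
  simp

lemma monIrr_dvd_prod {Fq : Type*} [Field Fq] (T : Finset (MonIrr Fq)) (P : MonIrr Fq) :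
    P.1 ∣ ∏ Q ∈ T, Q.1 ↔ P ∈ T := by
  constructor
  · intro h
    obtain ⟨Q, hQ, hd⟩ := (P.2.2.prime.dvd_finsetProd_iff _).1 h
    have := P.2.2.associated_of_dvd Q.2.2 hd
    have := eq_of_monic_of_associated P.2.1 Q.2.1 this
    rwa [Subtype.ext this]
  · intro h
    exact Finset.dvd_prod_of_mem (fun Q : MonIrr Fq => Q.1) h

lemma monIrr_coprime {Fq : Type*} [Field Fq] {P Q : MonIrr Fq} (h : P ≠ Q) :
    IsCoprime P.1 Q.1 := by
  rcases dvd_or_isCoprime P.1 Q.1 P.2.2 with h1 | h1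
  · exact absurd (Subtype.ext (eq_of_monic_of_associated P.2.1 Q.2.1
      (P.2.2.associated_of_dvd Q.2.2 h1))) h
  · exact h1

lemma natDegree_prod_monIrr {Fq : Type*} [Field Fq] (T : Finset (MonIrr Fq)) :
    (∏ Q ∈ T, Q.1).natDegree = ∑ Q ∈ T, Q.1.natDegree :=
  natDegree_prod_of_monic _ _ fun Q _ => Q.2.1

lemma omegaCount_prod {Fq : Type*} [Field Fq] (T : Finset (MonIrr Fq)) :
    omegaCount Fq (∏ Q ∈ T, Q.1) = T.card := by
  let e : {P : Polynomial Fq // P.Monic ∧ Irreducible P ∧ P ∣ ∏ Q ∈ T, Q.1} ≃ T :=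
    { toFun := fun P => ⟨⟨P.1, P.2.1, P.2.2.1⟩, (monIrr_dvd_prod T _).1 P.2.2.2⟩
      invFun := fun P => ⟨P.1.1, P.1.2.1, P.1.2.2, (monIrr_dvd_prod T _).2 P.2⟩
      left_inv := fun P => rfl
      right_inv := fun P => rfl }
  rw [omegaCount, Nat.card_congr e]
  simp

lemma squarefree_prod_monIrr {Fq : Type*} [Field Fq] (T : Finset (MonIrr Fq)) :
    Squarefree (∏ Q ∈ T, Q.1) := by
  refine Finset.squarefree_prod_of_pairwise_isCoprime ?_ fun Q _ => Q.2.2.squarefree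
  intro P _ Q _ h
  exact (monIrr_coprime h).isRelPrime

lemma exists_monIrr_dvd {Fq : Type*} [Field Fq] {c : Fq[X]} (hc : c.Monic) (h1 : c ≠ 1) :
    ∃ P : MonIrr Fq, P.1 ∣ c := by
  have : ¬ IsUnit c := fun h => h1 (hc.eq_one_of_isUnit h)
  obtain ⟨P, hP, hi, hd⟩ := exists_monic_irreducible_factor c this
  exact ⟨⟨P, hP, hi⟩, hd⟩

/-- primes of degree at most `N` -/
lemma finite_S (Fq : Type*) [Field Fq] [Fintype Fq] (N : ℕ) :
    {P : MonIrr Fq | P.1.natDegree ≤ N}.Finite := by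
  have : (⋃ n ∈ Set.Iic N, {D : Fq[X] | D.Monic ∧ D.natDegree = n}).Finite :=
    (Set.finite_Iic N).biUnion fun n _ => finite_monic Fq n
  refine Set.Finite.of_finite_image (f := Subtype.val) (this.subset ?_)
    Subtype.val_injective.injOn
  rintro _ ⟨P, hP, rfl⟩
  simp only [Set.mem_iUnion]
  exact ⟨P.1.natDegree, hP, P.2.1, rfl⟩

def primesLE (Fq : Type*) [Field Fq] [Fintype Fq] (N : ℕ) : Finset (MonIrr Fq) :=
  (finite_S Fq N).toFinset

lemma mem_primesLE {Fq : Type*} [Field Fq] [Fintype Fq] {N : ℕ} {P : MonIrr Fq} :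
    P ∈ primesLE Fq N ↔ P.1.natDegree ≤ N := by
  simp [primesLE]

lemma sqf_eq_prod {Fq : Type*} [Field Fq] [Fintype Fq] {D : Fq[X]} (hD : D.Monic)
    (hs : Squarefree D) {N : ℕ} (hN : D.natDegree ≤ N) :
    ∃ T ⊆ primesLE Fq N, ∏ Q ∈ T, Q.1 = D := by
  classical
  refine ⟨(primesLE Fq N).filter (fun P => P.1 ∣ D), Finset.filter_subset _ _, ?_⟩
  set T := (primesLE Fq N).filter (fun P => P.1 ∣ D)
  have hdv : ∏ Q ∈ T, Q.1 ∣ D := by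
    refine Finset.prod_dvd_of_coprime ?_ ?_
    · intro P _ Q _ h
      exact monIrr_coprime h
    · intro P hP
      exact (Finset.mem_filter.1 hP).2
  obtain ⟨c, hc⟩ := hdv
  have hm : (∏ Q ∈ T, Q.1).Monic := monic_prod_of_monic _ _ fun Q _ => Q.2.1
  have hcm : c.Monic := by
    refine hm.of_mul_monic_left ?_
    rwa [← hc]
  by_contra hne
  have hc1 : c ≠ 1 := by
    rintro rfl
    exact hne (by rw [hc, mul_one])
  obtain ⟨P, hP⟩ := exists_monIrr_dvd hcm hc1
  have hPD : P.1 ∣ D := hc ▸ hP.mul_left _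
  have hPT : P ∈ T := by
    refine Finset.mem_filter.2 ⟨mem_primesLE.2 ?_, hPD⟩
    exact (natDegree_le_of_dvd hPD hD.ne_zero).trans hN
  have h2 : P.1 * P.1 ∣ D := by
    rw [hc]
    exact mul_dvd_mul ((monIrr_dvd_prod T P).2 hPT) hP
  exact P.2.2.not_isUnit (hs _ h2)

/-- the weighted count -/
def aCoef (Fq : Type*) [Field Fq] (n : ℕ) : ℝ :=
  ∑ᶠ D ∈ {D : Polynomial Fq | D.Monic ∧ Squarefree D ∧ D.natDegree = n},
            (2 : ℝ) ^ omegaCount Fq D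

def polyA {Fq : Type*} [Field Fq] (S : Finset (MonIrr Fq)) : PowerSeries ℝ :=
  ∏ P ∈ S, (1 + 2 * PowerSeries.X ^ P.1.natDegree)

def polyQ {Fq : Type*} [Field Fq] (S : Finset (MonIrr Fq)) : PowerSeries ℝ :=
  ∏ P ∈ S, (1 - PowerSeries.X ^ P.1.natDegree)

lemma coeff_polyA (Fq : Type*) [Field Fq] [Fintype Fq] {n N : ℕ} (h : n ≤ N) :
    PowerSeries.coeff n (polyA (primesLE Fq N)) = aCoef Fq n := by
  classical
  have e1 : polyA (primesLE Fq N) = ∑ T ∈ (primesLE Fq N).powerset,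
      PowerSeries.C ((2:ℝ) ^ T.card) * PowerSeries.X ^ (∏ Q ∈ T, Q.1).natDegree := by
    rw [polyA, Finset.prod_one_add]
    refine Finset.sum_congr rfl fun T _ => ?_
    rw [Finset.prod_mul_distrib, Finset.prod_pow_eq_pow_sum, natDegree_prod_monIrr]
    simp only [Finset.prod_const, map_pow, map_ofNat]
  rw [e1, map_sum]
  simp only [PowerSeries.coeff_C_mul, PowerSeries.coeff_X_pow, mul_ite, mul_one, mul_zero]
  rw [← Finset.sum_filter, aCoef]
  set F := (primesLE Fq N).powerset.filter (fun T => n = (∏ Q ∈ T, Q.1).natDegree)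
  have himg : {D : Polynomial Fq | D.Monic ∧ Squarefree D ∧ D.natDegree = n} =
      ((F.image (fun T => ∏ Q ∈ T, Q.1) : Finset Fq[X]) : Set Fq[X]) := by
    ext D
    simp only [Set.mem_ofPred_eq, Finset.coe_image, Set.mem_image, Finset.mem_coe, F,
      Finset.mem_filter, Finset.mem_powerset]
    constructor
    · rintro ⟨hD, hs, hn⟩
      obtain ⟨T, hT, rfl⟩ := sqf_eq_prod hD hs (hn.le.trans h)
      exact ⟨T, ⟨hT, hn.symm⟩, rfl⟩
    · rintro ⟨T, ⟨hT, hn⟩, rfl⟩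
      exact ⟨monic_prod_of_monic _ _ fun Q _ => Q.2.1, squarefree_prod_monIrr T, hn.symm⟩
  rw [himg, finsum_mem_coe_finset, Finset.sum_image]
  · refine Finset.sum_congr rfl fun T _ => ?_
    rw [omegaCount_prod]
  · intro T _ T' _ hTT
    ext P
    rw [← monIrr_dvd_prod, ← monIrr_dvd_prod]
    simp only at hTT
    rw [hTT]

/-- monic polynomials of degree `n` with all prime factors in `S` -/
def smoothSet {Fq : Type*} [Field Fq] (S : Set (MonIrr Fq)) (n : ℕ) : Set Fq[X] :=
  {D | (D.Monic ∧ D.natDegree = n) ∧ ∀ P : MonIrr Fq, P.1 ∣ D → P ∈ S}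

lemma smoothSet_finite {Fq : Type*} [Field Fq] [Fintype Fq] (S : Set (MonIrr Fq)) (n : ℕ) :
    (smoothSet S n).Finite := (finite_monic Fq n).subset fun _ h => h.1

lemma smooth_step {Fq : Type*} [Field Fq] [Fintype Fq] (S : Set (MonIrr Fq)) (P : MonIrr Fq)
    (hP : P ∉ S) (n : ℕ) :
    (smoothSet (insert P S) n).ncard = (smoothSet S n).ncard +
      if P.1.natDegree ≤ n then (smoothSet (insert P S) (n - P.1.natDegree)).ncard else 0 := by
  have h1 : smoothSet (insert P S) n = smoothSet S n ∪
      {D | D ∈ smoothSet (insert P S) n ∧ P.1 ∣ D} := by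
    ext D
    constructor
    · intro hD
      by_cases hd : P.1 ∣ D
      · exact Or.inr ⟨hD, hd⟩
      · refine Or.inl ⟨hD.1, fun Q hQ => ?_⟩
        rcases hD.2 Q hQ with rfl | h
        · exact absurd hQ hd
        · exact h
    · rintro (h | h)
      · exact ⟨h.1, fun Q hQ => Or.inr (h.2 Q hQ)⟩
      · exact h.1
  have hdisj : Disjoint (smoothSet S n) {D | D ∈ smoothSet (insert P S) n ∧ P.1 ∣ D} := by
    rw [Set.disjoint_left]
    intro D hD hD'
    exact hP (hD.2 P hD'.2)
  conv_lhs => rw [h1]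
  rw [Set.ncard_union_eq hdisj (smoothSet_finite _ _)
    ((smoothSet_finite (insert P S) n).subset fun _ h => h.1)]
  congr 1
  split_ifs with hn
  · rw [← Set.ncard_image_of_injective (smoothSet (insert P S) (n - P.1.natDegree))
      (mul_right_injective₀ P.2.1.ne_zero)]
    congr 1
    ext D
    constructor
    · rintro ⟨⟨⟨hm, hd⟩, hD⟩, ⟨c, rfl⟩⟩
      have hc : c.Monic := P.2.1.of_mul_monic_left hm
      refine ⟨c, ⟨⟨hc, ?_⟩, fun Q hQ => hD Q (hQ.mul_left _)⟩, rfl⟩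
      rw [P.2.1.natDegree_mul hc] at hd
      omega
    · rintro ⟨c, ⟨⟨hc, hd⟩, hD⟩, rfl⟩
      refine ⟨⟨⟨P.2.1.mul hc, ?_⟩, ?_⟩, dvd_mul_right _ _⟩
      · rw [P.2.1.natDegree_mul hc]; omega
      · intro Q hQ
        rcases Q.2.2.prime.dvd_or_dvd hQ with h | h
        · left
          exact Subtype.ext (eq_of_monic_of_associated Q.2.1 P.2.1
            (Q.2.2.associated_of_dvd P.2.2 h))
        · exact hD Q h
  · rw [Set.ncard_eq_zero ((smoothSet_finite (insert P S) n).subset fun _ h => h.1)]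
    ext D
    simp only [Set.mem_ofPred_eq, Set.mem_empty_iff_false, iff_false, not_and]
    intro hD hd
    apply hn
    rw [← hD.1.2]
    exact natDegree_le_of_dvd hd hD.1.1.ne_zero

def smoothSeries {Fq : Type*} [Field Fq] (S : Set (MonIrr Fq)) : PowerSeries ℝ :=
  PowerSeries.mk fun n => ((smoothSet S n).ncard : ℝ)

lemma smoothSeries_step {Fq : Type*} [Field Fq] [Fintype Fq] (S : Set (MonIrr Fq)) (P : MonIrr Fq)
    (hP : P ∉ S) :
    (1 - PowerSeries.X ^ P.1.natDegree) * smoothSeries (insert P S) = smoothSeries S := by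
  ext n
  rw [sub_mul, one_mul, map_sub, PowerSeries.coeff_X_pow_mul']
  simp only [smoothSeries, PowerSeries.coeff_mk]
  rw [smooth_step S P hP n]
  push_cast
  ring

lemma polyQ_mul {Fq : Type*} [Field Fq] [Fintype Fq] (S : Finset (MonIrr Fq)) :
    polyQ S * smoothSeries (S : Set (MonIrr Fq)) = 1 := by
  classical
  induction S using Finset.induction_on with
  | empty =>
    ext n
    simp only [polyQ, smoothSeries, Finset.prod_empty, one_mul, PowerSeries.coeff_mk,
      PowerSeries.coeff_one]
    have : smoothSet ((∅ : Finset (MonIrr Fq)) : Set (MonIrr Fq)) n = if n = 0 then {1} else ∅ := by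
      ext D
      constructor
      · rintro ⟨⟨hm, hd⟩, h⟩
        have : D = 1 := by
          by_contra hne
          obtain ⟨P, hP⟩ := exists_monIrr_dvd hm hne
          simpa using h P hP
        subst this
        simp at hd
        simp [← hd]
      · split_ifs with h
        · rintro rfl
          subst h
          refine ⟨⟨monic_one, natDegree_one⟩, fun P hP => ?_⟩
          exact absurd (isUnit_of_dvd_one hP) P.2.2.not_isUnit
        · simp
    rw [this]
    split_ifs <;> simp
  | insert P S hP ih =>
    rw [polyQ, Finset.prod_insert hP, mul_right_comm, Finset.coe_insert,
      smoothSeries_step _ P (by simpa using hP), mul_comm]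
    exact ih

lemma coeff_smooth (Fq : Type*) [Field Fq] [Fintype Fq] {n N : ℕ} (h : n ≤ N) :
    PowerSeries.coeff n (smoothSeries (primesLE Fq N : Set (MonIrr Fq))) =
      (Fintype.card Fq : ℝ) ^ n := by
  rw [smoothSeries, PowerSeries.coeff_mk, ← Nat.cast_pow, ← ncard_monic]
  congr 2
  ext D
  refine ⟨fun hD => hD.1, fun hD => ⟨hD, fun P hP => mem_primesLE.2 ?_⟩⟩
  exact ((natDegree_le_of_dvd hP hD.1.ne_zero).trans hD.2.le).trans h

lemma geom_mul (c : ℝ) : (1 - PowerSeries.C c * PowerSeries.X) *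
    (PowerSeries.mk fun n => c ^ n) = 1 := by
  ext n
  rw [sub_mul, one_mul, map_sub, mul_assoc, PowerSeries.coeff_C_mul]
  cases n with
  | zero => simp
  | succ n =>
    rw [PowerSeries.coeff_succ_X_mul]
    simp [PowerSeries.coeff_one]
    ring

lemma geom_mul' (c : ℝ) : (1 - PowerSeries.C c * PowerSeries.X) *
    (PowerSeries.mk fun n => ((n:ℝ) + 1) * c ^ n) = PowerSeries.mk fun n => c ^ n := by
  ext n
  rw [sub_mul, one_mul, map_sub, mul_assoc, PowerSeries.coeff_C_mul]
  cases n with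
  | zero => simp
  | succ n =>
    rw [PowerSeries.coeff_succ_X_mul]
    simp
    ring

lemma polyQ_congr (Fq : Type*) [Field Fq] [Fintype Fq] (N : ℕ) :
    PowerSeries.X ^ (N + 1) ∣ polyQ (primesLE Fq N) -
      (1 - PowerSeries.C (Fintype.card Fq : ℝ) * PowerSeries.X) := by
  have h1 := polyQ_mul (primesLE Fq N)
  have h2 := geom_mul (Fintype.card Fq : ℝ)
  set Q := polyQ (primesLE Fq N)
  set M := smoothSeries (primesLE Fq N : Set (MonIrr Fq)) with hM
  set L := (1 - PowerSeries.C (Fintype.card Fq : ℝ) * PowerSeries.X)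
  set Z := (PowerSeries.mk fun n => (Fintype.card Fq : ℝ) ^ n) with hZ
  have : Q - L = (Q * L) * (Z - M) := by
    linear_combination (L) * h1 - Q * h2
  rw [this]
  refine Dvd.dvd.mul_left (PowerSeries.X_pow_dvd_iff.2 fun m hm => ?_) _
  rw [map_sub, hM, coeff_smooth Fq (by omega), hZ, PowerSeries.coeff_mk, sub_self]

/-- The coefficients of `G`. -/
def gSeries (Fq : Type*) [Field Fq] [Fintype Fq] : PowerSeries ℝ :=
  (PowerSeries.mk (aCoef Fq)) * (1 - PowerSeries.C (Fintype.card Fq : ℝ) * PowerSeries.X) ^ 2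

lemma aCoef_eq (Fq : Type*) [Field Fq] [Fintype Fq] (n : ℕ) :
    aCoef Fq n = ∑ k ∈ Finset.range (n + 1), PowerSeries.coeff k (gSeries Fq) *
      (((n - k : ℕ) : ℝ) + 1) * (Fintype.card Fq : ℝ) ^ (n - k) := by
  have h : PowerSeries.mk (aCoef Fq) = gSeries Fq *
      (PowerSeries.mk fun n => ((n:ℝ) + 1) * (Fintype.card Fq : ℝ) ^ n) := by
    have h1 := geom_mul (Fintype.card Fq : ℝ)
    have h2 := geom_mul' (Fintype.card Fq : ℝ)
    rw [gSeries, mul_assoc, sq, mul_assoc, h2, h1, mul_one]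
  have h3 := congrArg (PowerSeries.coeff n) h
  rw [PowerSeries.coeff_mk, PowerSeries.coeff_mul,
    Finset.Nat.sum_antidiagonal_eq_sum_range_succ_mk] at h3
  rw [h3]
  refine Finset.sum_congr rfl fun k _ => ?_
  rw [PowerSeries.coeff_mk]
  ring

/-- truncated Euler product for `G` -/
def polyG {Fq : Type*} [Field Fq] (S : Finset (MonIrr Fq)) : ℝ[X] :=
  ∏ P ∈ S, (1 - 3 * X ^ (2 * P.1.natDegree) + 2 * X ^ (3 * P.1.natDegree))

lemma polyG_eq {Fq : Type*} [Field Fq] (S : Finset (MonIrr Fq)) :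
    (polyG S : PowerSeries ℝ) = polyA S * (polyQ S) ^ 2 := by
  rw [polyG, polyA, polyQ, ← Finset.prod_pow, ← Finset.prod_mul_distrib,
    ← Polynomial.coeToPowerSeries.ringHom_apply, map_prod]
  refine Finset.prod_congr rfl fun P _ => ?_
  simp only [map_add, map_sub, map_mul, map_pow, map_one, map_ofNat,
    Polynomial.coeToPowerSeries.ringHom_apply, Polynomial.coe_X]
  ring

lemma coeff_polyG (Fq : Type*) [Field Fq] [Fintype Fq] {n N : ℕ} (h : n ≤ N) :
    (polyG (primesLE Fq N)).coeff n = PowerSeries.coeff n (gSeries Fq) := by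
  rw [← Polynomial.coeff_coe, polyG_eq, ← sub_eq_zero, ← map_sub]
  refine PowerSeries.X_pow_dvd_iff.1 ?_ n (show n < N + 1 by omega)
  have hA : PowerSeries.X ^ (N + 1) ∣ polyA (primesLE Fq N) - PowerSeries.mk (aCoef Fq) := by
    refine PowerSeries.X_pow_dvd_iff.2 fun m hm => ?_
    rw [map_sub, coeff_polyA Fq (by omega), PowerSeries.coeff_mk, sub_self]
  have hQ := polyQ_congr Fq N
  rw [gSeries]
  obtain ⟨a, ha⟩ := hA
  obtain ⟨b, hb⟩ := hQ
  set Q := polyQ (primesLE Fq N)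
  set L := (1 - PowerSeries.C (Fintype.card Fq : ℝ) * PowerSeries.X)
  refine ⟨a * Q ^ 2 + PowerSeries.mk (aCoef Fq) * b * (Q + L), ?_⟩
  linear_combination Q ^ 2 * ha + PowerSeries.mk (aCoef Fq) * (Q + L) * hb

lemma abs_coeff_prod {ι : Type*} (s : Finset ι) (p h : ι → ℝ[X])
    (H : ∀ i n, |(p i).coeff n| ≤ (h i).coeff n) (n : ℕ) :
    |(∏ i ∈ s, p i).coeff n| ≤ (∏ i ∈ s, h i).coeff n := by
  classical
  induction s using Finset.induction_on generalizing n with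
  | empty =>
    simp only [Finset.prod_empty, coeff_one]
    split_ifs <;> simp
  | insert i s hi ih =>
    rw [Finset.prod_insert hi, Finset.prod_insert hi, coeff_mul, coeff_mul]
    refine (Finset.abs_sum_le_sum_abs _ _).trans (Finset.sum_le_sum fun x _ => ?_)
    rw [abs_mul]
    exact mul_le_mul (H _ _) (ih _) (abs_nonneg _) ((abs_nonneg _).trans (H _ _))

lemma coeff_mul_pow_le_eval (h : ℝ[X]) (hh : ∀ n, 0 ≤ h.coeff n) {r : ℝ} (hr : 0 ≤ r) (n : ℕ) :
    h.coeff n * r ^ n ≤ h.eval r := by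
  have hlt : h.natDegree < max h.natDegree n + 1 := by omega
  rw [eval_eq_sum_range' hlt]
  exact Finset.single_le_sum (f := fun i => h.coeff i * r ^ i)
    (fun i _ => mul_nonneg (hh i) (pow_nonneg hr i)) (Finset.mem_range.2 (by omega))

lemma factor_coeff (d n : ℕ) : |((1 - 3 * X ^ (2 * d) + 2 * X ^ (3 * d) : ℝ[X])).coeff n| ≤
    ((1 + 3 * X ^ (2 * d) + 2 * X ^ (3 * d) : ℝ[X])).coeff n := by
  have h3 : (3 : ℝ[X]) = C 3 := (map_ofNat C 3).symm
  have h2 : (2 : ℝ[X]) = C 2 := (map_ofNat C 2).symm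
  rw [h3, h2]
  simp only [coeff_add, coeff_sub, coeff_one, coeff_C_mul, coeff_X_pow]
  split_ifs <;> norm_num

lemma card_deg_le (Fq : Type*) [Field Fq] [Fintype Fq] (S : Finset (MonIrr Fq)) (d : ℕ) :
    (S.filter (fun P => P.1.natDegree = d)).card ≤ (Fintype.card Fq) ^ d := by
  classical
  rw [← ncard_monic, ← Set.ncard_coe_finset]
  refine Set.ncard_le_ncard_of_injOn Subtype.val ?_ Subtype.val_injective.injOn (finite_monic Fq d)
  intro P hP
  exact ⟨P.2.1, by simpa using (Finset.mem_filter.1 (Finset.mem_coe.1 hP)).2⟩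

lemma sum_primes_le (Fq : Type*) [Field Fq] [Fintype Fq] {r : ℝ} (hr : 0 ≤ r)
    (hr1 : (Fintype.card Fq : ℝ) * r ^ 2 < 1) (N : ℕ) :
    ∑ P ∈ primesLE Fq N, r ^ (2 * P.1.natDegree) ≤ (1 - (Fintype.card Fq : ℝ) * r ^ 2)⁻¹ := by
  rw [← Finset.sum_fiberwise_of_maps_to (t := Finset.range (N + 1))
    (g := fun P : MonIrr Fq => P.1.natDegree)
    (fun P hP => Finset.mem_range.2 (by have := mem_primesLE.1 hP; omega))]
  have h0 : 0 ≤ (Fintype.card Fq : ℝ) * r ^ 2 := by positivity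
  rw [← tsum_geometric_of_lt_one h0 hr1]
  refine le_trans (Finset.sum_le_sum fun d _ => ?_)
    ((summable_geometric_of_lt_one h0 hr1).sum_le_tsum (Finset.range (N + 1))
      fun i _ => pow_nonneg h0 i)
  have : ∑ P ∈ (primesLE Fq N).filter (fun P => P.1.natDegree = d), r ^ (2 * P.1.natDegree) =
      ((primesLE Fq N).filter (fun P => P.1.natDegree = d)).card * r ^ (2 * d) := by
    rw [← nsmul_eq_mul, ← Finset.sum_const]
    refine Finset.sum_congr rfl fun P hP => ?_
    rw [(Finset.mem_filter.1 hP).2]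
  rw [this, mul_pow, ← pow_mul]
  refine mul_le_mul_of_nonneg_right ?_ (by positivity)
  exact_mod_cast card_deg_le Fq _ d

lemma polyG_bound (Fq : Type*) [Field Fq] [Fintype Fq] {r : ℝ} (hr : 0 ≤ r) (hr1 : r ≤ 1)
    (hr2 : (Fintype.card Fq : ℝ) * r ^ 2 < 1) :
    ∃ C : ℝ, ∀ N n, |(polyG (primesLE Fq N)).coeff n| * r ^ n ≤ C := by
  refine ⟨Real.exp (5 * (1 - (Fintype.card Fq : ℝ) * r ^ 2)⁻¹), fun N n => ?_⟩
  set h : ℝ[X] := ∏ P ∈ primesLE Fq N,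
    (1 + 3 * X ^ (2 * P.1.natDegree) + 2 * X ^ (3 * P.1.natDegree)) with hh
  have h1 : ∀ n, |(polyG (primesLE Fq N)).coeff n| ≤ h.coeff n := fun n =>
    abs_coeff_prod _ _ _ (fun P n => factor_coeff _ n) n
  have h2 : |(polyG (primesLE Fq N)).coeff n| * r ^ n ≤ h.eval r :=
    (mul_le_mul_of_nonneg_right (h1 n) (pow_nonneg hr n)).trans
      (coeff_mul_pow_le_eval h (fun n => (abs_nonneg _).trans (h1 n)) hr n)
  refine h2.trans ?_
  rw [hh, eval_prod]
  have h3 : ∏ P ∈ primesLE Fq N, eval r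
      (1 + 3 * X ^ (2 * P.1.natDegree) + 2 * X ^ (3 * P.1.natDegree) : ℝ[X]) ≤
      ∏ P ∈ primesLE Fq N, Real.exp (5 * r ^ (2 * P.1.natDegree)) := by
    refine Finset.prod_le_prod (fun P _ => ?_) fun P _ => ?_
    · simp only [eval_add, eval_mul, eval_pow, eval_X, eval_one, eval_ofNat]
      positivity
    · simp only [eval_add, eval_mul, eval_pow, eval_X, eval_one, eval_ofNat]
      have := Real.add_one_le_exp (5 * r ^ (2 * P.1.natDegree))
      have h4 : r ^ (3 * P.1.natDegree) ≤ r ^ (2 * P.1.natDegree) :=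
        pow_le_pow_of_le_one hr hr1 (by omega)
      linarith
  refine h3.trans ?_
  rw [← Real.exp_sum, ← Finset.mul_sum]
  exact Real.exp_le_exp.2 (mul_le_mul_of_nonneg_left (sum_primes_le Fq hr hr2 N) (by norm_num))

lemma tendsto_polyG (Fq : Type*) [Field Fq] [Fintype Fq] {r : ℝ} (hr : 0 < r) {C : ℝ}
    (hC : ∀ N n, |(polyG (primesLE Fq N)).coeff n| * r ^ n ≤ C) {u : ℝ} (hu : 0 ≤ u) (hur : u < r) :
    Tendsto (fun N => (polyG (primesLE Fq N)).eval u) atTop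
      (𝓝 (∑' n, PowerSeries.coeff n (gSeries Fq) * u ^ n)) := by
  have he : ∀ N, (polyG (primesLE Fq N)).eval u =
      ∑' n, (polyG (primesLE Fq N)).coeff n * u ^ n := by
    intro N
    rw [eval_eq_sum_range, tsum_eq_sum]
    intro n hn
    rw [coeff_eq_zero_of_natDegree_lt, zero_mul]
    simpa using hn
  simp only [he]
  refine tendsto_tsum_of_dominated_convergence (bound := fun n => C * (u / r) ^ n) ?_ ?_ ?_
  · exact (summable_geometric_of_lt_one (by positivity) ((div_lt_one hr).2 hur)).mul_left _
  · intro n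
    refine tendsto_const_nhds.congr' ?_
    filter_upwards [eventually_ge_atTop n] with N hN
    rw [coeff_polyG Fq hN]
  · refine Eventually.of_forall fun N n => ?_
    rw [norm_mul, norm_pow, Real.norm_eq_abs, Real.norm_eq_abs, abs_of_nonneg hu, div_pow,
      ← mul_div_assoc, le_div_iff₀ (by positivity)]
    calc _ = (|(polyG (primesLE Fq N)).coeff n| * r ^ n) * u ^ n := by ring
      _ ≤ _ := mul_le_mul_of_nonneg_right (hC N n) (by positivity)

lemma G_eq (Fq : Type*) [Field Fq] [Fintype Fq] {r : ℝ} (hr : 0 < r) {C : ℝ}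
    (hC : ∀ N n, |(polyG (primesLE Fq N)).coeff n| * r ^ n ≤ C) {u : ℝ} (hu : 0 ≤ u) (hur : u < r)
    {Gu : ℝ} (hG : HasProd (fun P : MonIrr Fq =>
        1 - 3 * u ^ (2 * P.1.natDegree) + 2 * u ^ (3 * P.1.natDegree)) Gu) :
    Gu = ∑' n, PowerSeries.coeff n (gSeries Fq) * u ^ n := by
  refine tendsto_nhds_unique ?_ (tendsto_polyG Fq hr hC hu hur)
  have hS : Tendsto (primesLE Fq) atTop atTop := by
    refine tendsto_atTop_finset_of_monotone (fun a b hab P hP => ?_) fun P => ?_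
    · exact mem_primesLE.2 ((mem_primesLE.1 hP).trans hab)
    · exact ⟨P.1.natDegree, mem_primesLE.2 le_rfl⟩
  have h := (show Tendsto _ _ _ from hG).comp hS
  refine h.congr fun N => ?_
  simp [polyG, eval_prod]

lemma analytic_part (g a : ℕ → ℝ) (G : ℝ → ℝ) (q r C : ℝ) (hq : 0 < q) (hr : 0 < r)
    (hqr : q⁻¹ < r) (hC : ∀ n, |g n| * r ^ n ≤ C)
    (ha : ∀ n, a n = ∑ k ∈ Finset.range (n + 1), g k * (((n - k : ℕ) : ℝ) + 1) * q ^ (n - k))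
    (hG : ∀ u, 0 ≤ u → u < r → G u = ∑' n, g n * u ^ n) :
    ∃ C', ∀ n : ℕ, |a n - q ^ n * (G q⁻¹ * (n + 1) - q⁻¹ * deriv G q⁻¹)| ≤ C' * (r⁻¹) ^ n := by
  set x := q⁻¹ with hx
  have hx0 : 0 < x := inv_pos.2 hq
  have hqx : q * x = 1 := mul_inv_cancel₀ hq.ne'
  have hg : ∀ n, |g n| ≤ C * (r⁻¹) ^ n := by
    intro n
    rw [inv_pow, ← div_eq_mul_inv, le_div_iff₀ (by positivity)]
    exact hC n
  have hC0 : 0 ≤ C := (mul_nonneg (abs_nonneg _) (pow_nonneg hr.le 0)).trans (hC 0)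
  -- summability
  have hs1 : ∀ s, 0 ≤ s → s < r → Summable fun n : ℕ => (s * r⁻¹) ^ n := fun s h0 h1 =>
    summable_geometric_of_lt_one (by positivity) (by rwa [← div_eq_mul_inv, div_lt_one hr])
  have hs2 : ∀ s, 0 ≤ s → s < r → Summable fun n : ℕ => (n : ℝ) * (s * r⁻¹) ^ n := fun s h0 h1 => by
    have := summable_pow_mul_geometric_of_norm_lt_one (R := ℝ) 1 (r := s * r⁻¹) (by
      rw [Real.norm_eq_abs, abs_of_nonneg (by positivity)]
      rwa [← div_eq_mul_inv, div_lt_one hr])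
    simpa using this
  have hsum1 : Summable fun n => g n * x ^ n := by
    refine Summable.of_norm_bounded ((hs1 x hx0.le hqr).mul_left C) fun n => ?_
    rw [norm_mul, norm_pow, Real.norm_eq_abs, Real.norm_eq_abs, abs_of_pos hx0, mul_pow,
      mul_comm (x ^ n), ← mul_assoc]
    exact mul_le_mul_of_nonneg_right (hg n) (by positivity)
  have hsum2 : Summable fun n : ℕ => (n : ℝ) * (g n * x ^ n) := by
    refine Summable.of_norm_bounded ((hs2 x hx0.le hqr).mul_left C) fun n => ?_
    rw [norm_mul, norm_mul, norm_pow, Real.norm_eq_abs, Real.norm_eq_abs, Real.norm_eq_abs, abs_of_pos hx0, mul_pow,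
      abs_of_nonneg (Nat.cast_nonneg n)]
    calc (n : ℝ) * (|g n| * x ^ n) ≤ n * ((C * (r⁻¹) ^ n) * x ^ n) := by
          gcongr
          exact hg n
      _ = _ := by ring
  -- derivative
  have hder : HasDerivAt G (∑' n : ℕ, g n * (n * x ^ (n - 1))) x := by
    set ρ := (x + r) / 2 with hρ
    have hρ0 : 0 < ρ := by positivity
    have hxρ : x < ρ := by linarith
    have hρr : ρ < r := by linarith
    have hmem : x ∈ Metric.ball (0:ℝ) ρ := by
      simpa [abs_of_pos hx0] using hxρ
    have h1 : HasDerivAt (fun z => ∑' n, g n * z ^ n) (∑' n : ℕ, g n * (n * x ^ (n - 1))) x := by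
      refine hasDerivAt_tsum_of_isPreconnected (g := fun n z => g n * z ^ n)
        (g' := fun n z => g n * ((n : ℝ) * z ^ (n - 1)))
        (u := fun n : ℕ => C / ρ * ((n : ℝ) * (ρ * r⁻¹) ^ n)) (t := Metric.ball (0:ℝ) ρ)
        ((hs2 ρ hρ0.le hρr).mul_left _) Metric.isOpen_ball
        (convex_ball (0:ℝ) ρ).isPreconnected ?_ ?_ hmem hsum1 hmem
      · intro n y _
        exact (hasDerivAt_pow n y).const_mul _
      · intro n y hy
        have hy' : |y| ≤ ρ := by
          have : |y| < ρ := by simpa using hy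
          exact this.le
        rcases n with _ | n
        · simp
        · rw [norm_mul, norm_mul, norm_pow, Real.norm_eq_abs, Real.norm_eq_abs, Real.norm_eq_abs,
            abs_of_nonneg (show (0:ℝ) ≤ ((n + 1 : ℕ) : ℝ) from Nat.cast_nonneg _), Nat.add_sub_cancel]
          calc |g (n+1)| * (((n+1 : ℕ) : ℝ) * |y| ^ n)
              ≤ (C * (r⁻¹) ^ (n+1)) * (((n+1 : ℕ) : ℝ) * ρ ^ n) := by
                gcongr
                exact hg _
            _ = _ := by
              rw [mul_pow, pow_succ ρ n]
              field_simp
    refine h1.congr_of_eventuallyEq ?_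
    filter_upwards [Ioo_mem_nhds hx0 hqr] with u hu
    exact hG u hu.1.le hu.2
  have hxd : x * deriv G x = ∑' n : ℕ, (n : ℝ) * (g n * x ^ n) := by
    rw [hder.deriv, ← tsum_mul_left]
    refine tsum_congr fun n => ?_
    rcases n with _ | n
    · simp
    · rw [Nat.add_sub_cancel]; ring
  refine ⟨C * (x * r⁻¹) * ∑' j : ℕ, (j : ℝ) * (x * r⁻¹) ^ j, fun n => ?_⟩
  have hF : Summable fun k : ℕ => (g k * x ^ k) * (n + 1) - (k : ℝ) * (g k * x ^ k) :=
    (hsum1.mul_right _).sub hsum2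
  have e1 : G x * (n + 1) - x * deriv G x =
      ∑' k : ℕ, ((g k * x ^ k) * (n + 1) - (k : ℝ) * (g k * x ^ k)) := by
    rw [hxd, hG x hx0.le hqr, (hsum1.mul_right _).tsum_sub hsum2, tsum_mul_right]
  have e2 : a n = q ^ n * ∑ k ∈ Finset.range (n + 1),
      ((g k * x ^ k) * (n + 1) - (k : ℝ) * (g k * x ^ k)) := by
    rw [ha, Finset.mul_sum]
    refine Finset.sum_congr rfl fun k hk => ?_
    have hk' : k ≤ n := by have := Finset.mem_range.1 hk; omega
    have : q ^ n = q ^ (n - k) * q ^ k := by rw [← pow_add]; congr 1; omega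
    have h1 : q ^ k * x ^ k = 1 := by rw [← mul_pow, hqx, one_pow]
    rw [this, Nat.cast_sub hk']
    linear_combination (-(q ^ (n - k) * g k * ((n : ℝ) + 1 - k))) * h1
  rw [e1, ← hF.sum_add_tsum_nat_add (n + 1), e2, mul_add, sub_add_cancel_left, abs_neg, abs_mul,
    abs_of_pos (pow_pos hq n)]
  have hb : |∑' j : ℕ, ((g (j + (n + 1)) * x ^ (j + (n + 1))) * ((n:ℝ) + 1) -
      ((j + (n + 1) : ℕ) : ℝ) * (g (j + (n + 1)) * x ^ (j + (n + 1))))| ≤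
      (C * (x * r⁻¹) ^ (n + 1)) * ∑' j : ℕ, (j : ℝ) * (x * r⁻¹) ^ j := by
    rw [← Real.norm_eq_abs]
    refine tsum_of_norm_bounded ((hs2 x hx0.le hqr).hasSum.mul_left _) fun j => ?_
    have : (g (j + (n + 1)) * x ^ (j + (n + 1))) * ((n:ℝ) + 1) -
      ((j + (n + 1) : ℕ) : ℝ) * (g (j + (n + 1)) * x ^ (j + (n + 1))) =
      -(j * (g (j + (n + 1)) * x ^ (j + (n + 1)))) := by push_cast; ring
    rw [this, norm_neg, norm_mul, norm_mul, norm_pow, Real.norm_eq_abs, Real.norm_eq_abs,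
      Real.norm_eq_abs, abs_of_pos hx0, abs_of_nonneg (Nat.cast_nonneg j)]
    calc (j : ℝ) * (|g (j + (n+1))| * x ^ (j + (n+1)))
        ≤ j * ((C * (r⁻¹) ^ (j + (n+1))) * x ^ (j + (n+1))) := by
          gcongr
          exact hg _
      _ = _ := by ring
  calc _ ≤ q ^ n * ((C * (x * r⁻¹) ^ (n + 1)) * ∑' j : ℕ, (j : ℝ) * (x * r⁻¹) ^ j) :=
        mul_le_mul_of_nonneg_left hb (by positivity)
    _ = _ := by
      have h1 : q ^ n * x ^ n = 1 := by rw [← mul_pow, hqx, one_pow]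
      set T := ∑' j : ℕ, (j : ℝ) * (x * r⁻¹) ^ j
      rw [pow_succ, mul_pow]
      linear_combination (C * (r⁻¹) ^ n * (x * r⁻¹) * T) * h1

theorem stmt11 (Fq : Type*) [Field Fq] [Fintype Fq] (q : ℕ)
    (hq : Fintype.card Fq = q)
    (G : ℝ → ℝ)
    (hG : ∀ u : ℝ, 0 ≤ u → u < (q : ℝ) ^ (-(1 / 2 : ℝ)) →
      HasProd (fun P : {P : Polynomial Fq // P.Monic ∧ Irreducible P} =>
        1 - 3 * u ^ (2 * P.1.natDegree) + 2 * u ^ (3 * P.1.natDegree)) (G u)) :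
    ∀ ε > (0 : ℝ),
      (fun n : ℕ =>
          (∑ᶠ D ∈ {D : Polynomial Fq | D.Monic ∧ Squarefree D ∧ D.natDegree = n},
            (2 : ℝ) ^ omegaCount Fq D) -
          (q : ℝ) ^ n * (G (q : ℝ)⁻¹ * ((n : ℝ) + 1) - (q : ℝ)⁻¹ * deriv G (q : ℝ)⁻¹))
        =O[atTop] (fun n : ℕ => (q : ℝ) ^ ((1 / 2 + ε) * (n : ℝ))) := by
  intro ε hε
  have hq1 : (1 : ℝ) < q := by
    rw [← hq]
    exact_mod_cast Fintype.one_lt_card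
  have hq0 : (0 : ℝ) < q := by linarith
  set δ := min ε (1 / 4) with hδ
  have hδ0 : 0 < δ := lt_min hε (by norm_num)
  have hδ4 : δ ≤ 1 / 4 := min_le_right _ _
  have hδε : δ ≤ ε := min_le_left _ _
  set r : ℝ := (q : ℝ) ^ (-(1 / 2 + δ)) with hr
  have hr0 : 0 < r := Real.rpow_pos_of_pos hq0 _
  have hr1 : r ≤ 1 := Real.rpow_le_one_of_one_le_of_nonpos hq1.le (by linarith)
  have hrh : r < (q : ℝ) ^ (-(1 / 2 : ℝ)) := Real.rpow_lt_rpow_of_exponent_lt hq1 (by linarith)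
  have hqr : (q : ℝ)⁻¹ < r := by
    rw [← Real.rpow_neg_one]
    exact Real.rpow_lt_rpow_of_exponent_lt hq1 (by linarith)
  have hr2 : (Fintype.card Fq : ℝ) * r ^ 2 < 1 := by
    rw [hq, hr, ← Real.rpow_natCast, ← Real.rpow_mul hq0.le]
    nth_rewrite 1 [← Real.rpow_one (q : ℝ)]
    rw [← Real.rpow_add hq0]
    exact Real.rpow_lt_one_of_one_lt_of_neg hq1 (by push_cast; linarith)
  obtain ⟨C, hC⟩ := polyG_bound Fq hr0.le hr1 hr2
  obtain ⟨C', hC'⟩ := analytic_part (fun n => PowerSeries.coeff n (gSeries Fq)) (aCoef Fq) G q r C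
    hq0 hr0 hqr (fun n => by rw [← coeff_polyG Fq (le_refl n)]; exact hC n n)
    (fun n => by rw [aCoef_eq, hq])
    (fun u hu hur => G_eq Fq hr0 hC hu hur (hG u hu (hur.trans hrh)))
  refine IsBigO.of_bound (|C'|) (Eventually.of_forall fun n => ?_)
  rw [Real.norm_eq_abs, Real.norm_of_nonneg (Real.rpow_nonneg hq0.le _)]
  refine (hC' n).trans ?_
  have h1 : (r⁻¹) ^ n ≤ (q : ℝ) ^ ((1 / 2 + ε) * (n : ℝ)) := by
    rw [hr, ← Real.rpow_neg hq0.le, neg_neg, ← Real.rpow_natCast, ← Real.rpow_mul hq0.le]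
    refine Real.rpow_le_rpow_of_exponent_le hq1.le ?_
    gcongr
  calc C' * (r⁻¹) ^ n ≤ |C'| * (r⁻¹) ^ n :=
        mul_le_mul_of_nonneg_right (le_abs_self _) (by positivity)
    _ ≤ _ := mul_le_mul_of_nonneg_left h1 (abs_nonneg _)
end
end

section
/- Let q be any prime power. Then for every ε > 0, as n → ∞, Σ_D 2^{ω(D)} = (1 − q^{−1}) · [ ∏_{P : deg(P) even} ((q^{deg(P)} + 2)(q^{deg(P)} − 1)) / (q^{deg(P)}(q^{deg(P)} + 1)) ] · q^{2n} + O(q^{(1+ε)n}), where the sum runs over all squarefree monic polynomials D ∈ A of degree 2n all of whose monic irreducible factors have even degree, and the (convergent) product runs over all monic irreducible P of A of even degree. -/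
open Polynomial Filter Asymptotics Topology

noncomputable section

set_option linter.unusedSectionVars false

section partA
variable {Fq : Type*} [Field Fq] [Fintype Fq]

lemma pa_card (n : ℕ) : Nat.card {D : Fq[X] // D.Monic ∧ D.natDegree = n} = Fintype.card Fq ^ n := by
  rw [Nat.card_congr ((monicEquivDegreeLT n).trans (degreeLTEquiv Fq n).toEquiv)]
  simp [Nat.card_eq_fintype_card]

instance pa_fin (n : ℕ) : Finite {D : Fq[X] // D.Monic ∧ D.natDegree = n} :=
  Finite.of_equiv _ ((monicEquivDegreeLT n).trans (degreeLTEquiv Fq n).toEquiv).symm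

/-- monic polynomials split by degree -/
def paEquiv : (Σ n : ℕ, {D : Fq[X] // D.Monic ∧ D.natDegree = n}) ≃ {D : Fq[X] // D.Monic} where
  toFun x := ⟨x.2.1, x.2.2.1⟩
  invFun D := ⟨D.1.natDegree, D.1, D.2, rfl⟩
  left_inv := by rintro ⟨n, D, h, rfl⟩; rfl
  right_inv := by rintro ⟨D, h⟩; rfl

lemma pa_summable (r : ℝ) (h0 : 0 ≤ r) (h1 : (Fintype.card Fq : ℝ) * r < 1) :
    Summable (fun D : {D : Fq[X] // D.Monic} => r ^ D.1.natDegree) := by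
  rw [← paEquiv.summable_iff]
  rw [summable_sigma_of_nonneg (fun _ => by simp; positivity)]
  refine ⟨fun n => Summable.of_finite, ?_⟩
  have : ∀ n : ℕ, ∑' y : {D : Fq[X] // D.Monic ∧ D.natDegree = n},
      ((fun D : {D : Fq[X] // D.Monic} => r ^ D.1.natDegree) ∘ paEquiv) ⟨n, y⟩ =
        ((Fintype.card Fq : ℝ) * r) ^ n := by
    intro n
    have h : ∀ y : {D : Fq[X] // D.Monic ∧ D.natDegree = n},
      ((fun D : {D : Fq[X] // D.Monic} => r ^ D.1.natDegree) ∘ paEquiv) ⟨n, y⟩ = r ^ n := by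
      rintro ⟨y, hy, hn⟩
      simp [paEquiv, hn]
    simp_rw [h]
    rw [tsum_const, pa_card, mul_pow]
    simp
  simp_rw [this]
  exact summable_geometric_of_lt_one (by positivity) h1

lemma pa_hasSum (u : ℂ) (h1 : (Fintype.card Fq : ℝ) * ‖u‖ < 1) :
    HasSum (fun D : {D : Fq[X] // D.Monic} => u ^ D.1.natDegree)
      (1 - (Fintype.card Fq : ℂ) * u)⁻¹ := by
  have hs : Summable (fun D : {D : Fq[X] // D.Monic} => u ^ D.1.natDegree) := by
    apply Summable.of_norm
    simpa using pa_summable (Fq := Fq) ‖u‖ (norm_nonneg _) h1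
  have h2 := (paEquiv.hasSum_iff.mpr hs.hasSum).sigma (g := fun n => ((Fintype.card Fq : ℂ) * u) ^ n) (by
    intro n
    have h : ∀ y : {D : Fq[X] // D.Monic ∧ D.natDegree = n},
      ((fun D : {D : Fq[X] // D.Monic} => u ^ D.1.natDegree) ∘ paEquiv) ⟨n, y⟩ = u ^ n := by
      rintro ⟨y, hy, hn⟩
      simp [paEquiv, hn]
    simp_rw [h]
    have hsf : Summable (fun _ : {D : Fq[X] // D.Monic ∧ D.natDegree = n} => u ^ n) := Summable.of_finite
    have := hsf.hasSum
    rw [tsum_const, pa_card] at this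
    rw [mul_pow]
    simpa using this)
  have h3 := hasSum_geometric_of_norm_lt_one (ξ := (Fintype.card Fq : ℂ) * u) (by simpa using h1)
  rw [← h2.unique h3]
  exact hs.hasSum

lemma pa_hasProd (u : ℂ) (h1 : (Fintype.card Fq : ℝ) * ‖u‖ < 1) :
    HasProd (fun P : {P : Fq[X] // P.Monic ∧ Irreducible P} => 1 - u ^ P.1.natDegree)
      (1 - (Fintype.card Fq : ℂ) * u) := by
  classical
  have hsum := pa_hasSum (Fq := Fq) u h1
  have hsumn := pa_summable (Fq := Fq) ‖u‖ (norm_nonneg _) h1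
  set f : {D : Fq[X] // D.Monic} → ℂ := fun D => u ^ D.1.natDegree with hf
  have hne : (1 - (Fintype.card Fq : ℂ) * u) ≠ 0 := by
    intro h
    have h2 : (Fintype.card Fq : ℂ) * u = 1 := by linear_combination -h
    have := congrArg norm h2
    simp at this
    linarith
  let T : Finset {P : Fq[X] // P.Monic ∧ Irreducible P} → {D : Fq[X] // D.Monic} → ℂ :=
    fun S D => if ∀ P ∈ S, ¬ P.1 ∣ D.1 then f D else 0
  have hTs : ∀ S, Summable (T S) := fun S => by
    apply Summable.of_norm_bounded hsumn
    intro D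
    simp only [T]
    split_ifs
    · simp [hf]
    · simp
  have hT : ∀ S, ∑' D, T S D = (∏ P ∈ S, (1 - u ^ P.1.natDegree)) * (1 - (Fintype.card Fq : ℂ) * u)⁻¹ := by
    intro S
    induction S using Finset.induction_on with
    | empty => simpa [T] using hsum.tsum_eq
    | insert P S hPS ih =>
      rw [Finset.prod_insert hPS, mul_assoc, ← ih]
      let g : {D : Fq[X] // D.Monic} → {D : Fq[X] // D.Monic} := fun D => ⟨P.1 * D.1, P.2.1.mul D.2⟩
      have hg : Function.Injective g := by
        intro D E h
        simp only [g, Subtype.mk.injEq] at h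
        exact Subtype.ext (mul_left_cancel₀ P.2.1.ne_zero h)
      let R : {D : Fq[X] // D.Monic} → ℂ := fun D => if P.1 ∣ D.1 then T S D else 0
      have hR : T S = fun D => T (insert P S) D + R D := by
        funext D
        simp only [T, R, Finset.forall_mem_insert]
        by_cases h1 : P.1 ∣ D.1 <;> simp [h1]
      have hRg : ∀ D, R (g D) = u ^ P.1.natDegree * T S D := by
        intro D
        have : (∀ Q ∈ S, ¬ Q.1 ∣ P.1 * D.1) ↔ (∀ Q ∈ S, ¬ Q.1 ∣ D.1) := by
          refine forall₂_congr fun Q hQ => not_congr ?_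
          constructor
          · intro h
            rcases Q.2.2.prime.dvd_or_dvd h with h | h
            · exfalso
              apply hPS
              have : Q = P := Subtype.ext (eq_of_monic_of_associated Q.2.1 P.2.1
                (Q.2.2.associated_of_dvd P.2.2 h))
              rwa [← this]
            · exact h
          · exact fun h => h.mul_left _
        simp only [R, T, g, this, dvd_mul_right, if_true, mul_ite, mul_zero, hf]
        rw [P.2.1.natDegree_mul D.2, pow_add]
      have hRs : Summable R := by
        apply Summable.of_norm_bounded hsumn
        intro D
        simp only [R, T]
        split_ifs
        · simp [hf]
        · simp
        · simp
      have hsupp : Function.support R ⊆ Set.range g := by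
        intro D hD
        have : P.1 ∣ D.1 := by
          by_contra h
          simp [R, h] at hD
        obtain ⟨E, hE⟩ := this
        exact ⟨⟨E, P.2.1.of_mul_monic_left (hE ▸ D.2)⟩, Subtype.ext hE.symm⟩
      have e1 : ∑' D, R D = u ^ P.1.natDegree * ∑' D, T S D := by
        rw [← hg.tsum_eq hsupp, ← tsum_mul_left]
        exact tsum_congr hRg
      have e2 : ∑' D, T S D = ∑' D, T (insert P S) D + ∑' D, R D := by
        conv_lhs => rw [hR]
        exact (hTs _).tsum_add hRs
      linear_combination -e2 - e1
  have hlim : Tendsto (fun S => ∑' D, T S D) atTop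
      (𝓝 (∑' D : {D : Fq[X] // D.Monic}, if D.1 = 1 then (1:ℂ) else 0)) := by
    refine tendsto_tsum_of_dominated_convergence hsumn ?_ ?_
    · intro D
      by_cases hD : D.1 = 1
      · simp only [hD, if_true]
        refine tendsto_const_nhds.congr fun S => ?_
        simp only [T, hD]
        rw [if_pos]
        · simp [hf, hD]
        · intro P _ h
          exact P.2.2.not_isUnit (isUnit_of_dvd_one h)
      · simp only [hD, if_false]
        obtain ⟨P, hPm, hPi, hPD⟩ := Polynomial.exists_monic_irreducible_factor D.1 (by
          intro h; exact hD (D.2.isUnit_iff.mp h))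
        refine tendsto_const_nhds.congr' ?_
        filter_upwards [eventually_ge_atTop {(⟨P, hPm, hPi⟩ : {P : Fq[X] // P.Monic ∧ Irreducible P})}]
          with S hS
        simp only [T]
        rw [if_neg]
        push Not
        exact ⟨⟨P, hPm, hPi⟩, by simpa using hS, hPD⟩
    · refine Eventually.of_forall fun S D => ?_
      simp only [T]
      split_ifs
      · simp [hf]
      · simp
  have hone : (∑' D : {D : Fq[X] // D.Monic}, if D.1 = 1 then (1:ℂ) else 0) = 1 := by
    rw [tsum_eq_single ⟨1, monic_one⟩]
    · simp
    · rintro ⟨D, hD⟩ h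
      have : D ≠ 1 := fun h' => h (Subtype.ext h')
      simp [this]
  rw [hone] at hlim
  simp_rw [hT] at hlim
  have := hlim.mul_const (1 - (Fintype.card Fq : ℂ) * u)
  rw [one_mul] at this
  refine this.congr fun S => ?_
  rw [mul_assoc, inv_mul_cancel₀ hne, mul_one]

end partA

section partB
variable {Fq : Type*} [Field Fq] [Fintype Fq]

/-- monic irreducibles of even degree -/
abbrev EvP (Fq : Type*) [Field Fq] := {P : Fq[X] // P.Monic ∧ Irreducible P ∧ Even P.natDegree}

/-- half of the degree -/
def hd (P : EvP Fq) : ℕ := P.1.natDegree / 2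

lemma two_hd (P : EvP Fq) : 2 * hd P = P.1.natDegree := Nat.two_mul_div_two_of_even P.2.2.2

lemma hd_pos (P : EvP Fq) : 1 ≤ hd P := by
  have := two_hd P
  have := P.2.2.1.natDegree_pos
  omega

lemma pb_summable (r : ℝ) (h0 : 0 ≤ r) (h1 : (Fintype.card Fq : ℝ) * r < 1) :
    Summable (fun P : EvP Fq => r ^ (2 * hd P)) := by
  have := (pa_summable (Fq := Fq) r h0 h1).comp_injective
    (i := fun P : EvP Fq => ⟨P.1, P.2.1⟩) (by
      intro P Q h
      simpa [Subtype.ext_iff] using h)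
  refine this.congr fun P => ?_
  simp [two_hd]

lemma pb_two_le : (2 : ℝ) ≤ (Fintype.card Fq : ℝ) := by
  exact_mod_cast (Fintype.one_lt_card (α := Fq))

lemma pb_euler (z : ℂ) (hz : (Fintype.card Fq : ℝ) ^ 2 * ‖z‖ < 1) :
    HasProd (fun P : EvP Fq => (1 - z ^ hd P) / (1 + z ^ hd P))
      ((1 - (Fintype.card Fq : ℂ) ^ 2 * z) / (1 - (Fintype.card Fq : ℂ) * z)) := by
  have hq := pb_two_le (Fq := Fq)
  obtain ⟨u, hu⟩ := IsAlgClosed.exists_pow_nat_eq z (n := 2) (by norm_num)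
  have hnu : ‖u‖ ^ 2 = ‖z‖ := by rw [← hu, norm_pow]
  have h1 : (Fintype.card Fq : ℝ) * ‖u‖ < 1 := by
    have : ((Fintype.card Fq : ℝ) * ‖u‖) ^ 2 < 1 := by rw [mul_pow, hnu]; exact hz
    exact (sq_lt_one_iff₀ (by positivity)).mp this
  have hz1 : (Fintype.card Fq : ℝ) * ‖z‖ < 1 := by
    nlinarith [norm_nonneg z]
  have hu1 : ‖u‖ < 1 := by nlinarith [norm_nonneg u]
  have hne : (1 - (Fintype.card Fq : ℂ) * z) ≠ 0 := by
    intro h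
    have h2 : (Fintype.card Fq : ℂ) * z = 1 := by linear_combination -h
    have := congrArg norm h2
    simp at this
    linarith
  have a1 := pa_hasProd (Fq := Fq) u h1
  have a2 := pa_hasProd (Fq := Fq) (-u) (by simpa using h1)
  have a3 := pa_hasProd (Fq := Fq) z hz1
  have a4 := (a1.mul a2).div₀ a3 hne
  have e : (1 - (Fintype.card Fq : ℂ) * u) * (1 - (Fintype.card Fq : ℂ) * -u) /
      (1 - (Fintype.card Fq : ℂ) * z) =
      (1 - (Fintype.card Fq : ℂ) ^ 2 * z) / (1 - (Fintype.card Fq : ℂ) * z) := by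
    rw [← hu]; ring
  rw [e] at a4
  have hpow : ∀ d : ℕ, d ≠ 0 → ∀ w : ℂ, ‖w‖ < 1 → 1 - w ^ d ≠ 0 := by
    intro d hd w hw h
    have h2 : w ^ d = 1 := by linear_combination -h
    have h3 := congrArg norm h2
    rw [norm_pow, norm_one] at h3
    exact absurd h3 (pow_lt_one₀ (norm_nonneg _) hw hd).ne
  let i : EvP Fq → {P : Fq[X] // P.Monic ∧ Irreducible P} := fun P => ⟨P.1, P.2.1, P.2.2.1⟩
  have hi : Function.Injective i := by
    intro P Q h
    simpa [i, Subtype.ext_iff] using h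
  rw [← hi.hasProd_iff] at a4
  · refine a4.congr_fun ?_
    intro P
    have hk := two_hd P
    have hk0 := hd_pos P
    simp only [Function.comp, i, ← hk, ← hu]
    have n1 := hpow (2 * hd P) (by omega) (u ^ 2) (by rw [hu]; nlinarith [norm_nonneg z])
    have n2 : 1 + (u ^ 2) ^ hd P ≠ 0 := by
      intro h
      apply n1
      rw [mul_comm 2, pow_mul (u^2)]
      linear_combination (1 - (u ^ 2) ^ hd P) * h
    rw [div_eq_div_iff n2 n1]
    rw [pow_mul u, pow_mul (-u), mul_comm 2, pow_mul (u^2)]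
    ring
  · intro P hP
    have hodd : Odd P.1.natDegree := by
      rw [← Nat.not_even_iff_odd]
      intro h
      exact hP ⟨⟨P.1, P.2.1, P.2.2, h⟩, rfl⟩
    have n1 := hpow P.1.natDegree P.2.2.natDegree_pos.ne' z (by nlinarith [norm_nonneg z])
    rw [div_eq_one_iff_eq n1, hodd.neg_pow, ← hu]
    ring

/-- the local factor of the analytic part, minus one -/
def fac (P : EvP Fq) (z : ℂ) : ℂ := -2 * z ^ (2 * hd P) / (1 + z ^ hd P)

lemma fac_den (P : EvP Fq) (z : ℂ) (hz : ‖z‖ ≤ 1/2) : 1 / 2 ≤ ‖1 + z ^ hd P‖ := by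
  have h1 : ‖z ^ hd P‖ ≤ 1 / 2 := by
    rw [norm_pow]
    calc ‖z‖ ^ hd P ≤ ‖z‖ ^ 1 := pow_le_pow_of_le_one (norm_nonneg _) (by linarith) (hd_pos P)
      _ ≤ 1 / 2 := by simpa using hz
  have := norm_sub_norm_le (1 : ℂ) (-(z ^ hd P))
  rw [norm_pow] at h1
  simp at this
  linarith

lemma fac_bound (P : EvP Fq) (z : ℂ) (r : ℝ) (hz : ‖z‖ ≤ 1/2) (hr : ‖z‖ ≤ r) :
    ‖fac P z‖ ≤ 4 * r ^ (2 * hd P) := by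
  have h := fac_den P z hz
  rw [fac, norm_div, div_le_iff₀ (by linarith)]
  rw [norm_mul, norm_pow]
  have : ‖z‖ ^ (2 * hd P) ≤ r ^ (2 * hd P) := pow_le_pow_left₀ (norm_nonneg _) hr _
  have h0 : 0 ≤ r ^ (2 * hd P) := le_trans (by positivity) this
  simp only [norm_neg, Complex.norm_ofNat]
  nlinarith

/-- the analytic part -/
def HH (Fq : Type*) [Field Fq] (z : ℂ) : ℂ := ∏' P : EvP Fq, (1 + fac P z)

lemma HH_hasProd (z : ℂ) (hz : (Fintype.card Fq : ℝ) * ‖z‖ < 1) :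
    HasProd (fun P : EvP Fq => 1 + fac P z) (HH Fq z) := by
  have hq := pb_two_le (Fq := Fq)
  apply Multipliable.hasProd
  apply multipliable_one_add_of_summable
  refine Summable.of_nonneg_of_le (fun _ => norm_nonneg _) (fun P => fac_bound P z ‖z‖ ?_ le_rfl)
    ((pb_summable (Fq := Fq) ‖z‖ (norm_nonneg _) hz).mul_left 4)
  nlinarith [norm_nonneg z]

lemma HH_diff (r : ℝ) (hr : 0 ≤ r) (hr1 : (Fintype.card Fq : ℝ) * r < 1) :
    DifferentiableOn ℂ (HH Fq) (Metric.ball 0 r) := by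
  have hq := pb_two_le (Fq := Fq)
  have hr2 : r ≤ 1/2 := by nlinarith
  have hd : ∀ P : EvP Fq, DifferentiableOn ℂ (fac P) (Metric.ball 0 r) := by
    intro P z hz
    simp at hz
    have := fac_den P z (by linarith)
    have hne : 1 + z ^ hd P ≠ 0 := by
      intro h; rw [h] at this; norm_num at this
    unfold fac
    apply DifferentiableAt.differentiableWithinAt
    fun_prop (disch := assumption)
  have h := Summable.hasProdLocallyUniformlyOn_one_add (f := fun P : EvP Fq => fac P)
    (K := Metric.ball 0 r) Metric.isOpen_ball
    ((pb_summable (Fq := Fq) r hr hr1).mul_left 4)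
    (Eventually.of_forall fun P z hz => by
      simp at hz
      exact fac_bound P z r (by linarith) hz.le)
    (fun P => (hd P).continuousOn)
  rw [hasProdLocallyUniformlyOn_iff_tendstoLocallyUniformlyOn] at h
  refine h.differentiableOn (Eventually.of_forall fun S => ?_) Metric.isOpen_ball
  apply DifferentiableOn.fun_finsetProd
  intro P _
  exact (differentiableOn_const _).add (hd P)

lemma main_factor (z : ℂ) (hz : (Fintype.card Fq : ℝ) ^ 2 * ‖z‖ < 1) (g : ℂ)
    (hg : HasProd (fun P : EvP Fq => 1 + 2 * z ^ hd P) g) :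
    (1 - (Fintype.card Fq : ℂ) ^ 2 * z) * g = (1 - (Fintype.card Fq : ℂ) * z) * HH Fq z := by
  have hq := pb_two_le (Fq := Fq)
  have hz1 : (Fintype.card Fq : ℝ) * ‖z‖ < 1 := by
    nlinarith [norm_nonneg z]
  have hne : (1 - (Fintype.card Fq : ℂ) * z) ≠ 0 := by
    intro h
    have h2 : (Fintype.card Fq : ℂ) * z = 1 := by linear_combination -h
    have := congrArg norm h2
    simp at this
    linarith
  have h1 := hg.mul (pb_euler (Fq := Fq) z hz)
  have h2 := HH_hasProd (Fq := Fq) z hz1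
  have h3 := h1.unique (h2.congr_fun fun P => by
    have := fac_den P z (by nlinarith [norm_nonneg z])
    have hne : 1 + z ^ hd P ≠ 0 := by
      intro h; rw [h] at this; norm_num at this
    unfold fac
    field_simp
    ring)
  rw [← h3]
  field_simp

end partB

section partC
variable {Fq : Type*} [Field Fq] [Fintype Fq]

/-- the set of `D` occurring in the sum -/
def DS (Fq : Type*) [Field Fq] (n : ℕ) : Set Fq[X] :=
  {D : Polynomial Fq | D.Monic ∧ Squarefree D ∧ D.natDegree = 2 * n ∧
              ∀ P : Polynomial Fq, P.Monic → Irreducible P → P ∣ D → Even P.natDegree}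

/-- the sum -/
def aa (Fq : Type*) [Field Fq] (n : ℕ) : ℝ := ∑ᶠ D ∈ DS Fq n, (2 : ℝ) ^ omegaCount Fq D

lemma dvd_prod_iff (S : Finset (EvP Fq)) (Q : Fq[X]) (hQ : Q.Monic) (hQi : Irreducible Q) :
    Q ∣ ∏ P ∈ S, P.1 ↔ ∃ P ∈ S, P.1 = Q := by
  rw [hQi.prime.dvd_finsetProd_iff]
  constructor
  · rintro ⟨P, hP, h⟩
    exact ⟨P, hP, (eq_of_monic_of_associated hQ P.2.1 (hQi.associated_of_dvd P.2.2.1 h)).symm⟩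
  · rintro ⟨P, hP, rfl⟩
    exact ⟨P, hP, dvd_rfl⟩

lemma omega_prod (S : Finset (EvP Fq)) : omegaCount Fq (∏ P ∈ S, P.1) = S.card := by
  unfold omegaCount
  rw [← Fintype.card_coe S, ← Nat.card_eq_fintype_card]
  refine (Nat.card_congr (Equiv.ofBijective
    (fun P : S => ⟨P.1.1, P.1.2.1, P.1.2.2.1, Finset.dvd_prod_of_mem (fun P : EvP Fq => P.1) P.2⟩)
    ⟨?_, ?_⟩)).symm
  · intro P Q h
    have h2 : P.1.1 = Q.1.1 := Subtype.mk.inj h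
    exact Subtype.ext (Subtype.ext h2)
  · rintro ⟨Q, hQ, hQi, h⟩
    obtain ⟨P, hP, rfl⟩ := (dvd_prod_iff S Q hQ hQi).mp h
    exact ⟨⟨P, hP⟩, rfl⟩

lemma prod_bij (n : ℕ) : Set.BijOn (fun S : Finset (EvP Fq) => ∏ P ∈ S, P.1)
    {S | ∑ P ∈ S, hd P = n} (DS Fq n) := by
  classical
  refine ⟨?_, ?_, ?_⟩
  · intro S hS
    simp only [Set.mem_ofPred_eq] at hS
    refine ⟨monic_prod_of_monic _ _ fun P _ => P.2.1, ?_, ?_, ?_⟩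
    · apply Finset.squarefree_prod_of_pairwise_isCoprime
      · intro P _ Q _ hPQ
        apply IsCoprime.isRelPrime
        rw [P.2.2.1.coprime_iff_not_dvd]
        intro h
        exact hPQ (Subtype.ext (eq_of_monic_of_associated P.2.1 Q.2.1 (P.2.2.1.associated_of_dvd Q.2.2.1 h)))
      · exact fun P _ => P.2.2.1.squarefree
    · rw [natDegree_prod_of_monic _ _ fun P _ => P.2.1, ← hS, Finset.mul_sum]
      exact Finset.sum_congr rfl fun P _ => (two_hd P).symm
    · intro Q hQ hQi h
      obtain ⟨P, _, rfl⟩ := (dvd_prod_iff S Q hQ hQi).mp h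
      exact P.2.2.2
  · intro S _ T _ h
    simp only at h
    ext P
    have h1 := dvd_prod_iff S P.1 P.2.1 P.2.2.1
    have h2 := dvd_prod_iff T P.1 P.2.1 P.2.2.1
    rw [h, h2] at h1
    simpa [Subtype.ext_iff.symm] using h1.symm
  · rintro D ⟨hm, hsq, hdeg, hev⟩
    have hnd := (UniqueFactorizationMonoid.squarefree_iff_nodup_normalizedFactors hm.ne_zero).mp hsq
    set M := UniqueFactorizationMonoid.normalizedFactors D with hM
    have hprop : ∀ P ∈ M, P.Monic ∧ Irreducible P ∧ Even P.natDegree := by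
      intro P hP
      have h1 := UniqueFactorizationMonoid.irreducible_of_normalized_factor P hP
      have h2 := UniqueFactorizationMonoid.dvd_of_mem_normalizedFactors hP
      have h3 : P.Monic := by
        rw [← UniqueFactorizationMonoid.normalize_normalized_factor P hP]
        exact monic_normalize h1.ne_zero
      exact ⟨h3, h1, hev P h3 h1 h2⟩
    let S : Finset (EvP Fq) := (⟨M, hnd⟩ : Finset Fq[X]).subtype
      (fun P => P.Monic ∧ Irreducible P ∧ Even P.natDegree)
    have hprod : ∏ P ∈ S, P.1 = D := by
      rw [Finset.prod_subtype_of_mem (fun P => P) (fun P hP => hprop P hP)]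
      have h1 : ∏ P ∈ (⟨M, hnd⟩ : Finset Fq[X]), P = M.prod := by
        simp [Finset.prod]
      rw [h1]
      refine eq_of_monic_of_associated ?_ hm (UniqueFactorizationMonoid.prod_normalizedFactors hm.ne_zero)
      simpa using monic_multiset_prod_of_monic M id (fun P hP => (hprop P hP).1)
    refine ⟨S, ?_, hprod⟩
    have : (∏ P ∈ S, P.1).natDegree = 2 * n := by rw [hprod, hdeg]
    rw [natDegree_prod_of_monic _ _ fun P _ => P.2.1] at this
    simp_rw [← two_hd] at this
    rw [← Finset.mul_sum] at this
    simp only [Set.mem_ofPred_eq]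
    omega

lemma DS_finite (n : ℕ) : (DS Fq n).Finite := by
  have : Finite ↑{D : Fq[X] | D.Monic ∧ D.natDegree = 2 * n} := pa_fin (Fq := Fq) (2 * n)
  exact Set.Finite.subset (Set.toFinite {D : Fq[X] | D.Monic ∧ D.natDegree = 2 * n})
    fun D hD => ⟨hD.1, hD.2.2.1⟩

lemma G_hasSum (z : ℂ) (hz : (Fintype.card Fq : ℝ) ^ 2 * ‖z‖ < 1) :
    ∃ g : ℂ, HasProd (fun P : EvP Fq => 1 + 2 * z ^ hd P) g ∧
      HasSum (fun n => (aa Fq n : ℂ) * z ^ n) g := by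
  have hs : Summable (fun P : EvP Fq => ‖2 * z ^ hd P‖) := by
    have h := (pb_summable (Fq := Fq) (√‖z‖) (Real.sqrt_nonneg _) (by
      have : ((Fintype.card Fq : ℝ) * √‖z‖) ^ 2 < 1 := by
        rw [mul_pow, Real.sq_sqrt (norm_nonneg _)]; exact hz
      exact (sq_lt_one_iff₀ (by positivity)).mp this)).mul_left 2
    refine h.congr fun P => ?_
    rw [pow_mul, Real.sq_sqrt (norm_nonneg _)]
    simp
  have h1 := (summable_finsetProd_of_summable_norm hs).hasSum
  refine ⟨_, hasProd_one_add_of_hasSum_prod h1, ?_⟩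
  have h2 := h1.tsum_fiberwise (fun S => ∑ P ∈ S, hd P)
  refine h2.congr_fun ?_
  intro n
  have hfin : Set.Finite {S : Finset (EvP Fq) | ∑ P ∈ S, hd P = n} :=
    Set.BijOn.finite_iff_finite (prod_bij n) |>.mpr (DS_finite n)
  have e1 : aa Fq n = ∑ᶠ S ∈ {S : Finset (EvP Fq) | ∑ P ∈ S, hd P = n}, (2:ℝ) ^ S.card := by
    refine (finsum_mem_eq_of_bijOn _ (prod_bij n) ?_).symm
    intro S _
    rw [omega_prod]
  rw [e1, finsum_mem_eq_finite_toFinset_sum _ hfin]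
  have e2 : ((fun S : Finset (EvP Fq) => ∑ P ∈ S, hd P) ⁻¹' {n}) = ↑hfin.toFinset := by
    ext S; simp
  rw [e2, Finset.tsum_subtype' hfin.toFinset (fun S => ∏ P ∈ S, 2 * z ^ hd P)]
  push_cast
  rw [Finset.sum_mul]
  refine Finset.sum_congr rfl fun S hS => ?_
  simp at hS
  rw [Finset.prod_mul_distrib, Finset.prod_const, Finset.prod_pow_eq_pow_sum, hS]

end partC

section partD
variable {Fq : Type*} [Field Fq] [Fintype Fq]

/-- analytic function whose Taylor coefficients are the differences -/
def FF (Fq : Type*) [Field Fq] [Fintype Fq] (z : ℂ) : ℂ := (1 - (Fintype.card Fq : ℂ) * z) * HH Fq z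

/-- Taylor coefficients of `FF` -/
def cc (Fq : Type*) [Field Fq] [Fintype Fq] (n : ℕ) : ℂ :=
  ((n.factorial : ℂ))⁻¹ * iteratedDeriv n (FF Fq) 0

lemma cc_hasSum (z : ℂ) (hz : (Fintype.card Fq : ℝ) * ‖z‖ < 1) :
    HasSum (fun n => cc Fq n * z ^ n) (FF Fq z) := by
  have hq := pb_two_le (Fq := Fq)
  have hlt : ‖z‖ < ((Fintype.card Fq : ℝ))⁻¹ := by
    rwa [← one_div, lt_div_iff₀' (by linarith)]
  obtain ⟨r, hr1, hr2⟩ := exists_between hlt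
  have hr0 : 0 ≤ r := (norm_nonneg z).trans hr1.le
  have hr3 : (Fintype.card Fq : ℝ) * r < 1 := by
    rwa [← one_div, lt_div_iff₀' (by linarith)] at hr2
  have hd : DifferentiableOn ℂ (FF Fq) (Metric.ball 0 r) := by
    unfold FF
    exact DifferentiableOn.mul (by fun_prop) (HH_diff r hr0 hr3)
  have := Complex.hasSum_taylorSeries_on_ball hd (z := z) (by simpa using hr1)
  refine this.congr_fun fun n => ?_
  simp [cc]
  ring

/-- differences -/
def bb (Fq : Type*) [Field Fq] [Fintype Fq] : ℕ → ℂ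
  | 0 => aa Fq 0
  | n + 1 => aa Fq (n + 1) - (Fintype.card Fq : ℂ) ^ 2 * aa Fq n

lemma bb_hasSum (z : ℂ) (hz : (Fintype.card Fq : ℝ) ^ 2 * ‖z‖ < 1) :
    HasSum (fun n => bb Fq n * z ^ n) (FF Fq z) := by
  obtain ⟨g, hg1, hg2⟩ := G_hasSum (Fq := Fq) z hz
  rw [FF, ← main_factor z hz g hg1]
  have h1 := (hasSum_nat_add_iff' 1).mpr hg2
  have h2 := hg2.mul_left ((Fintype.card Fq : ℂ) ^ 2 * z)
  have h3 := h1.sub h2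
  rw [← hasSum_nat_add_iff' 1]
  simp only [Finset.range_one, Finset.sum_singleton, pow_zero, mul_one] at h3 ⊢
  have e : (1 - (Fintype.card Fq : ℂ) ^ 2 * z) * g - bb Fq 0 =
    g - (aa Fq 0 : ℂ) - (Fintype.card Fq : ℂ) ^ 2 * z * g := by
    simp only [bb]; ring
  rw [e]
  refine h3.congr_fun fun n => ?_
  simp only [bb]
  ring

lemma bb_eq_cc : bb Fq = cc Fq := by
  have hq := pb_two_le (Fq := Fq)
  have hev : ∀ᶠ z : ℂ in 𝓝 0, (Fintype.card Fq : ℝ) ^ 2 * ‖z‖ < 1 := by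
    have : Tendsto (fun z : ℂ => (Fintype.card Fq : ℝ) ^ 2 * ‖z‖) (𝓝 0) (𝓝 ((Fintype.card Fq : ℝ) ^ 2 * ‖(0:ℂ)‖)) :=
      (Continuous.tendsto (by fun_prop) _)
    simp only [norm_zero, mul_zero] at this
    exact this.eventually_lt_const one_pos
  have h1 : HasFPowerSeriesAt (FF Fq) (FormalMultilinearSeries.ofScalars ℂ (bb Fq)) 0 := by
    rw [hasFPowerSeriesAt_iff]
    filter_upwards [hev] with z hz
    simpa [FormalMultilinearSeries.coeff_ofScalars, mul_comm] using bb_hasSum z hz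
  have h2 : HasFPowerSeriesAt (FF Fq) (FormalMultilinearSeries.ofScalars ℂ (cc Fq)) 0 := by
    rw [hasFPowerSeriesAt_iff]
    filter_upwards [hev] with z hz
    have : (Fintype.card Fq : ℝ) * ‖z‖ < 1 := by nlinarith [norm_nonneg z]
    simpa [FormalMultilinearSeries.coeff_ofScalars, mul_comm] using cc_hasSum z this
  exact FormalMultilinearSeries.ofScalars_series_injective ℂ ℂ (h1.eq_formalMultilinearSeries h2)

lemma partial_sum (n : ℕ) : ∑ i ∈ Finset.range (n + 1), cc Fq i * (((Fintype.card Fq : ℂ) ^ 2)⁻¹) ^ i =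
    aa Fq n * (((Fintype.card Fq : ℂ) ^ 2)⁻¹) ^ n := by
  have hq : (Fintype.card Fq : ℂ) ≠ 0 := by simp
  rw [← bb_eq_cc]
  induction n with
  | zero => simp [bb]
  | succ n ih =>
    rw [Finset.sum_range_succ, ih]
    simp only [bb]
    have h2 : (Fintype.card Fq : ℂ) ^ 2 * ((Fintype.card Fq : ℂ) ^ 2)⁻¹ = 1 :=
      mul_inv_cancel₀ (pow_ne_zero 2 hq)
    rw [pow_succ (((Fintype.card Fq : ℂ) ^ 2)⁻¹) n]
    linear_combination (-(aa Fq n : ℂ) * (((Fintype.card Fq : ℂ) ^ 2)⁻¹) ^ n) * h2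

lemma const_eq : HH Fq (((Fintype.card Fq : ℂ) ^ 2)⁻¹) =
    ((∏' P : EvP Fq, (((Fintype.card Fq : ℝ)) ^ P.1.natDegree + 2) * ((Fintype.card Fq : ℝ) ^ P.1.natDegree - 1) /
                ((Fintype.card Fq : ℝ) ^ P.1.natDegree * ((Fintype.card Fq : ℝ) ^ P.1.natDegree + 1)) : ℝ) : ℂ) := by
  have hq := pb_two_le (Fq := Fq)
  set q : ℝ := (Fintype.card Fq : ℝ) with hqdef
  have hqc : (Fintype.card Fq : ℂ) = (q : ℂ) := by simp [hqdef]
  have hlt : q * q⁻¹ ^ 2 < 1 := by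
    have : q * q⁻¹ ^ 2 = q⁻¹ := by field_simp
    rw [this]
    exact inv_lt_one_of_one_lt₀ (by linarith)
  have hreal : ∀ P : EvP Fq, (q ^ P.1.natDegree + 2) * (q ^ P.1.natDegree - 1) /
      (q ^ P.1.natDegree * (q ^ P.1.natDegree + 1)) =
      1 + (-2 * (q⁻¹ ^ 2) ^ (2 * hd P) / (1 + (q⁻¹ ^ 2) ^ hd P)) := by
    intro P
    rw [← two_hd P, ← pow_mul, ← pow_mul, inv_pow, inv_pow, show 2 * (2 * hd P) = 2 * hd P + 2 * hd P by ring, pow_add]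
    have : 0 < q ^ (2 * hd P) := by positivity
    generalize q ^ (2 * hd P) = y at *
    field_simp
    ring
  have hfac : ∀ P : EvP Fq, fac P (((Fintype.card Fq : ℂ) ^ 2)⁻¹) =
      ((-2 * (q⁻¹ ^ 2) ^ (2 * hd P) / (1 + (q⁻¹ ^ 2) ^ hd P) : ℝ) : ℂ) := by
    intro P
    rw [fac, hqc]
    push_cast
    simp
  have hnorm : (Fintype.card Fq : ℝ) * ‖((Fintype.card Fq : ℂ) ^ 2)⁻¹‖ < 1 := by
    simpa using hlt
  have h1 := HH_hasProd (Fq := Fq) _ hnorm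
  have hm : Multipliable (fun P : EvP Fq => 1 + (-2 * (q⁻¹ ^ 2) ^ (2 * hd P) / (1 + (q⁻¹ ^ 2) ^ hd P))) := by
    apply multipliable_one_add_of_summable
    refine Summable.of_nonneg_of_le (fun _ => norm_nonneg _) (fun P => ?_)
      ((pb_summable (Fq := Fq) (q⁻¹ ^ 2) (by positivity) hlt).mul_left 4)
    have hb := fac_bound P (((Fintype.card Fq : ℂ) ^ 2)⁻¹) (q⁻¹ ^ 2) (by
      nlinarith [norm_nonneg (((Fintype.card Fq : ℂ) ^ 2)⁻¹)]) (by simp [hqdef])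
    rw [hfac, Complex.norm_real] at hb
    exact hb
  have h2 := hm.hasProd.map Complex.ofRealHom Complex.continuous_ofReal
  simp_rw [hreal]
  refine h1.unique (h2.congr_fun fun P => ?_)
  rw [hfac]
  simp

end partD

theorem stmt13 (Fq : Type*) [Field Fq] [Fintype Fq] (q : ℕ)
    (hq : Fintype.card Fq = q) :
    ∀ ε > (0 : ℝ),
      (fun n : ℕ =>
          (∑ᶠ D ∈ {D : Polynomial Fq | D.Monic ∧ Squarefree D ∧ D.natDegree = 2 * n ∧
              ∀ P : Polynomial Fq, P.Monic → Irreducible P → P ∣ D → Even P.natDegree},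
            (2 : ℝ) ^ omegaCount Fq D) -
          (1 - (q : ℝ)⁻¹) *
            (∏' P : {P : Polynomial Fq // P.Monic ∧ Irreducible P ∧ Even P.natDegree},
              ((q : ℝ) ^ P.1.natDegree + 2) * ((q : ℝ) ^ P.1.natDegree - 1) /
                ((q : ℝ) ^ P.1.natDegree * ((q : ℝ) ^ P.1.natDegree + 1))) *
            (q : ℝ) ^ (2 * n))
        =O[atTop] (fun n : ℕ => (q : ℝ) ^ ((1 + ε) * (n : ℝ))) := by
  intro ε hε
  subst hq
  have hq := pb_two_le (Fq := Fq)
  set C : ℝ := ∏' P : {P : Polynomial Fq // P.Monic ∧ Irreducible P ∧ Even P.natDegree},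
              ((Fintype.card Fq : ℝ) ^ P.1.natDegree + 2) * ((Fintype.card Fq : ℝ) ^ P.1.natDegree - 1) /
                ((Fintype.card Fq : ℝ) ^ P.1.natDegree * ((Fintype.card Fq : ℝ) ^ P.1.natDegree + 1)) with hC
  have hconst : HH Fq (((Fintype.card Fq : ℂ) ^ 2)⁻¹) = (C : ℂ) := const_eq
  change (fun n : ℕ => aa Fq n - (1 - (Fintype.card Fq : ℝ)⁻¹) * C * (Fintype.card Fq : ℝ) ^ (2 * n)) =O[atTop] _
  set q : ℝ := (Fintype.card Fq : ℝ) with hqdef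
  have hqc : (Fintype.card Fq : ℂ) = (q : ℂ) := by simp [hqdef]
  have hq0 : 0 < q := by linarith
  have hq1 : 1 < q := by linarith
  obtain ⟨δ, hδ0, hδ1, hδε⟩ : ∃ δ : ℝ, 0 < δ ∧ δ < 1 ∧ δ ≤ ε :=
    ⟨min ε (1/2), by positivity, by linarith [min_le_right ε (1/2)], min_le_left _ _⟩
  set ρ : ℝ := q ^ (-(1 + δ)) with hρ
  have hρ0 : 0 < ρ := Real.rpow_pos_of_pos hq0 _
  have hρ1 : q * ‖(ρ : ℂ)‖ < 1 := by
    rw [Complex.norm_real, Real.norm_of_nonneg hρ0.le]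
    calc q * ρ = q ^ (-δ) := by
          rw [hρ, ← Real.rpow_one_add' hq0.le (by linarith)]; congr 1; ring
      _ < 1 := Real.rpow_lt_one_of_one_lt_of_neg hq1 (by linarith)
  have hs := (cc_hasSum (Fq := Fq) (ρ : ℂ) hρ1).summable.norm
  set M := ∑' n, ‖cc Fq n * (ρ : ℂ) ^ n‖ with hM
  have hMb : ∀ n, ‖cc Fq n‖ * ρ ^ n ≤ M := by
    intro n
    have := hs.le_tsum n (fun _ _ => norm_nonneg _)
    rwa [norm_mul, norm_pow, Complex.norm_real, Real.norm_of_nonneg hρ0.le] at this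
  set s : ℝ := q ^ (δ - 1) with hsdef
  have hs0 : 0 < s := Real.rpow_pos_of_pos hq0 _
  have hs1 : s < 1 := Real.rpow_lt_one_of_one_lt_of_neg hq1 (by linarith)
  have hsρ : s * ρ = (q ^ 2)⁻¹ := by
    rw [hsdef, hρ, ← Real.rpow_add hq0, ← Real.rpow_natCast, ← Real.rpow_neg hq0.le]
    congr 1; push_cast; ring
  have hnorm : (Fintype.card Fq : ℝ) * ‖((Fintype.card Fq : ℂ) ^ 2)⁻¹‖ < 1 := by
    rw [hqc, ← hqdef]
    simp only [norm_inv, norm_pow, Complex.norm_real, Real.norm_of_nonneg hq0.le]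
    have : q * (q ^ 2)⁻¹ = q⁻¹ := by field_simp
    rw [this]
    exact inv_lt_one_of_one_lt₀ hq1
  have hsum := cc_hasSum (Fq := Fq) _ hnorm
  have hgeo : ∀ n, ‖cc Fq n * (((Fintype.card Fq : ℂ) ^ 2)⁻¹) ^ n‖ ≤ M * s ^ n := by
    intro n
    rw [hqc]
    simp only [norm_mul, norm_inv, norm_pow, Complex.norm_real, Real.norm_of_nonneg hq0.le]
    rw [← hsρ, mul_pow]
    calc ‖cc Fq n‖ * (s ^ n * ρ ^ n) = (‖cc Fq n‖ * ρ ^ n) * s ^ n := by ring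
      _ ≤ M * s ^ n := by gcongr; exact hMb n
  have hfin := norm_sub_le_of_geometric_bound_of_hasSum hs1 hgeo hsum
  refine IsBigO.of_bound (M * s / (1 - s)) (Eventually.of_forall fun n => ?_)
  have h1 := hfin (n + 1)
  rw [partial_sum] at h1
  have hFF : FF Fq (((Fintype.card Fq : ℂ) ^ 2)⁻¹) = (((1 - q⁻¹) * C : ℝ) : ℂ) := by
    rw [FF, hconst, hqc]
    have : (q : ℂ) ≠ 0 := by exact_mod_cast hq0.ne'
    push_cast
    field_simp
  have e : (aa Fq n : ℂ) * (((Fintype.card Fq : ℂ) ^ 2)⁻¹) ^ n - FF Fq (((Fintype.card Fq : ℂ) ^ 2)⁻¹) =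
      (((aa Fq n - (1 - q⁻¹) * C * q ^ (2 * n)) * (q ^ (2 * n))⁻¹ : ℝ) : ℂ) := by
    rw [hFF, hqc]
    have : (q : ℂ) ≠ 0 := by exact_mod_cast hq0.ne'
    push_cast
    rw [inv_pow, ← pow_mul]
    field_simp
  rw [e, Complex.norm_real, norm_mul, Real.norm_of_nonneg (r := (q ^ (2 * n))⁻¹) (by positivity),
    ← div_eq_mul_inv, div_le_iff₀ (by positivity)] at h1
  refine h1.trans ?_
  have hM0 : 0 ≤ M := tsum_nonneg fun _ => norm_nonneg _
  have e2 : s ^ n * q ^ (2 * n) = q ^ ((1 + δ) * (n : ℝ)) := by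
    rw [hsdef, ← Real.rpow_mul_natCast hq0.le, ← Real.rpow_natCast, ← Real.rpow_add hq0]
    congr 1; push_cast; ring
  have e3 : q ^ ((1 + δ) * (n : ℝ)) ≤ q ^ ((1 + ε) * (n : ℝ)) :=
    Real.rpow_le_rpow_of_exponent_le hq1.le (by gcongr)
  rw [Real.norm_of_nonneg (by positivity)]
  have h1s : 0 < 1 - s := by linarith
  calc M * s ^ (n + 1) / (1 - s) * q ^ (2 * n) = M * s / (1 - s) * (s ^ n * q ^ (2 * n)) := by ring
    _ ≤ _ := by rw [e2]; gcongr
end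
end

section
/- Let q be any prime power. For every real s > 1, ∏_{P : deg(P) even} (1 + 2q^{−deg(P)s}) = (1 − q^{2(1−s)})^{−1} · (1 − q^{1−2s}) · ∏_{P : deg(P) even} ((q^{deg(P)s} + 2)(q^{deg(P)s} − 1)) / (q^{deg(P)s}(q^{deg(P)s} + 1)), where the products run over all monic irreducible polynomials P of A = 𝔽_q[t] of even degree. Moreover the last product converges (is multipliable) for every real s > 1/2. -/
open Polynomial

section Helpers

open Filter Topology

variable {Fq : Type*} [Field Fq] [Fintype Fq]

lemma hasSum_fiber (y : ℝ) (n : ℕ) :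
    HasSum (fun a : {a : {a : Polynomial Fq // a.Monic} // a.1.natDegree = n} =>
      y ^ a.1.1.natDegree) (((Fintype.card Fq : ℝ) * y) ^ n) := by
  classical
  let e0 : {a : {a : Polynomial Fq // a.Monic} // a.1.natDegree = n} ≃
      {p : Polynomial Fq // p.Monic ∧ p.natDegree = n} :=
    Equiv.subtypeSubtypeEquivSubtypeInter (fun a : Polynomial Fq => a.Monic)
      (fun a => a.natDegree = n)
  let e := e0.trans ((monicEquivDegreeLT (R := Fq) n).trans (degreeLTEquiv Fq n).toEquiv)
  let _ : Fintype {a : {a : Polynomial Fq // a.Monic} // a.1.natDegree = n} :=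
    Fintype.ofEquiv _ e.symm
  have hc : Fintype.card {a : {a : Polynomial Fq // a.Monic} // a.1.natDegree = n}
      = Fintype.card Fq ^ n := by
    rw [Fintype.card_congr e]; simp
  convert hasSum_fintype _ using 1
  rw [Finset.sum_congr rfl (fun a _ => by rw [a.2]), Finset.sum_const, Finset.card_univ, hc,
    nsmul_eq_mul, mul_pow]
  push_cast
  rfl

lemma summable_monic (y : ℝ) (hy : |(Fintype.card Fq : ℝ) * y| < 1) :
    Summable (fun a : {a : Polynomial Fq // a.Monic} => |y| ^ a.1.natDegree) := by
  rw [← (Equiv.sigmaFiberEquiv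
    (fun a : {a : Polynomial Fq // a.Monic} => a.1.natDegree)).summable_iff]
  rw [summable_sigma_of_nonneg (fun x => by simp only [Function.comp]; positivity)]
  refine ⟨fun n => (hasSum_fiber |y| n).summable, ?_⟩
  have : ∀ n, ∑' a : {a : {a : Polynomial Fq // a.Monic} // a.1.natDegree = n},
      |y| ^ a.1.1.natDegree = ((Fintype.card Fq : ℝ) * |y|) ^ n :=
    fun n => (hasSum_fiber |y| n).tsum_eq
  simp only [Function.comp, Equiv.sigmaFiberEquiv, Equiv.coe_fn_mk]
  simp_rw [this]
  apply summable_geometric_of_lt_one (by positivity)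
  rwa [abs_mul, Nat.abs_cast] at hy

lemma hasSum_monic (y : ℝ) (hy : |(Fintype.card Fq : ℝ) * y| < 1) :
    HasSum (fun a : {a : Polynomial Fq // a.Monic} => y ^ a.1.natDegree)
      (1 - (Fintype.card Fq : ℝ) * y)⁻¹ := by
  rw [← (Equiv.sigmaFiberEquiv
    (fun a : {a : Polynomial Fq // a.Monic} => a.1.natDegree)).hasSum_iff]
  refine HasSum.sigma_of_hasSum (hasSum_geometric_of_abs_lt_one hy) (fun n => hasSum_fiber y n) ?_
  rw [Equiv.summable_iff]
  refine Summable.of_norm ?_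
  simpa using summable_monic y hy

open Classical in
/-- weight of monic polynomials prime to all elements of `S` -/
noncomputable def sieveWt (y : ℝ) (S : Finset {P : Polynomial Fq // P.Monic ∧ Irreducible P})
    (a : {a : Polynomial Fq // a.Monic}) : ℝ :=
  if ∃ P ∈ S, P.1 ∣ a.1 then 0 else y ^ a.1.natDegree

lemma sieveWt_le (y : ℝ) (S : Finset {P : Polynomial Fq // P.Monic ∧ Irreducible P})
    (a : {a : Polynomial Fq // a.Monic}) : ‖sieveWt y S a‖ ≤ |y| ^ a.1.natDegree := by
  unfold sieveWt
  split_ifs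
  · simp
  · simp

lemma sieveWt_summable (y : ℝ) (hy : |(Fintype.card Fq : ℝ) * y| < 1)
    (S : Finset {P : Polynomial Fq // P.Monic ∧ Irreducible P}) : Summable (sieveWt y S) :=
  Summable.of_norm_bounded (summable_monic y hy) (sieveWt_le y S)

lemma sieve_tsum (y : ℝ) (hy : |(Fintype.card Fq : ℝ) * y| < 1)
    (S : Finset {P : Polynomial Fq // P.Monic ∧ Irreducible P}) :
    ∑' a, sieveWt y S a =
      (∏ P ∈ S, (1 - y ^ P.1.natDegree)) * (1 - (Fintype.card Fq : ℝ) * y)⁻¹ := by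
  classical
  induction S using Finset.induction_on with
  | empty =>
    simp only [Finset.prod_empty, one_mul]
    rw [← (hasSum_monic y hy).tsum_eq]
    simp [sieveWt]
  | insert P S hP ih =>
    rw [Finset.prod_insert hP, mul_assoc, ← ih, sub_mul, one_mul, ← tsum_mul_left]
    let m : {a : Polynomial Fq // a.Monic} → {a : Polynomial Fq // a.Monic} :=
      fun a => ⟨P.1 * a.1, P.2.1.mul a.2⟩
    have hm : Function.Injective m := by
      intro a b h
      have := congrArg Subtype.val h
      exact Subtype.ext (mul_left_cancel₀ P.2.1.ne_zero this)
    let h : {a : Polynomial Fq // a.Monic} → ℝ := fun a => if P.1 ∣ a.1 then sieveWt y S a else 0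
    have h1 : ∑' a, y ^ P.1.natDegree * sieveWt y S a = ∑' a, h a := by
      rw [← hm.tsum_eq (f := h)]
      · refine tsum_congr fun a => ?_
        have hd : P.1 ∣ (m a).1 := dvd_mul_right _ _
        have hiff : (∃ Q ∈ S, Q.1 ∣ (m a).1) ↔ ∃ Q ∈ S, Q.1 ∣ a.1 := by
          refine exists_congr fun Q => and_congr_right fun hQ => ⟨fun hd => ?_, fun hd => ?_⟩
          · rcases (Q.2.2.prime.dvd_or_dvd hd) with h' | h'
            · exfalso
              have := eq_of_monic_of_associated Q.2.1 P.2.1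
                (Q.2.2.associated_of_dvd P.2.2 h')
              exact hP (Subtype.ext this ▸ hQ)
            · exact h'
          · exact hd.mul_left _
        simp only [h, if_pos hd, sieveWt, hiff]
        split_ifs
        · simp
        · rw [← pow_add]
          congr 1
          exact (P.2.1.natDegree_mul a.2).symm
      · intro a ha
        by_cases hd : P.1 ∣ a.1
        · obtain ⟨b, hb⟩ := hd
          have hbm : b.Monic := P.2.1.of_mul_monic_left (hb ▸ a.2)
          exact ⟨⟨b, hbm⟩, Subtype.ext hb.symm⟩
        · simp [h, hd] at ha
    have hh : Summable h := by
      refine Summable.of_norm_bounded (summable_monic y hy) fun a => ?_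
      simp only [h]
      split_ifs
      · exact sieveWt_le y S a
      · simp
    rw [h1, ← (sieveWt_summable y hy S).tsum_sub hh]
    refine tsum_congr fun a => ?_
    simp only [h, sieveWt, Finset.exists_mem_insert]
    by_cases h1 : P.1 ∣ a.1 <;> simp [h1]

lemma hasProd_irred (y : ℝ) (hy : |(Fintype.card Fq : ℝ) * y| < 1) :
    HasProd (fun P : {P : Polynomial Fq // P.Monic ∧ Irreducible P} => 1 - y ^ P.1.natDegree)
      (1 - (Fintype.card Fq : ℝ) * y) := by
  classical
  have hne : 1 - (Fintype.card Fq : ℝ) * y ≠ 0 := by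
    have := (abs_lt.mp hy).2
    linarith
  have key : Tendsto (fun S : Finset {P : Polynomial Fq // P.Monic ∧ Irreducible P} =>
      ∑' a, sieveWt y S a) atTop
      (𝓝 (∑' a : {a : Polynomial Fq // a.Monic}, if a = ⟨1, monic_one⟩ then (1 : ℝ) else 0)) := by
    refine tendsto_tsum_of_dominated_convergence (summable_monic y hy) (fun a => ?_)
      (Eventually.of_forall fun S a => sieveWt_le y S a)
    by_cases ha : a = ⟨1, monic_one⟩
    · subst ha
      refine tendsto_const_nhds.congr fun S => ?_
      have : ¬ ∃ P ∈ S, P.1 ∣ (1 : Polynomial Fq) := by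
        rintro ⟨P, -, hd⟩
        exact P.2.2.not_isUnit (isUnit_of_dvd_one hd)
      simp [sieveWt, this]
    · have hu : ¬ IsUnit a.1 := fun h => ha (Subtype.ext (a.2.eq_one_of_isUnit h))
      obtain ⟨g, hg, hi, hd⟩ := exists_monic_irreducible_factor a.1 hu
      refine tendsto_const_nhds.congr' ?_
      filter_upwards [eventually_ge_atTop {(⟨g, hg, hi⟩ :
        {P : Polynomial Fq // P.Monic ∧ Irreducible P})}] with S hS
      have : ∃ P ∈ S, P.1 ∣ a.1 := ⟨⟨g, hg, hi⟩, hS (by simp), hd⟩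
      simp [sieveWt, this, ha]
  rw [tsum_ite_eq] at key
  simp_rw [sieve_tsum y hy] at key
  have := key.mul_const (1 - (Fintype.card Fq : ℝ) * y)
  simp only [inv_mul_cancel_right₀ hne, one_mul] at this
  exact this

lemma hasProd_even (x : ℝ) (hx0 : 0 < x) (hx : (Fintype.card Fq : ℝ) * x < 1) :
    HasProd (fun P : {P : Polynomial Fq // P.Monic ∧ Irreducible P ∧ Even P.natDegree} =>
      (1 + x ^ P.1.natDegree) / (1 - x ^ P.1.natDegree))
      ((1 - (Fintype.card Fq : ℝ) ^ 2 * x ^ 2)⁻¹ * (1 - (Fintype.card Fq : ℝ) * x ^ 2)) := by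
  have hc : (1 : ℝ) < Fintype.card Fq := by exact_mod_cast Fintype.one_lt_card
  have hx1 : x < 1 := by nlinarith
  have hp : 0 < (Fintype.card Fq : ℝ) * x := by positivity
  have h1 := hasProd_irred (Fq := Fq) x (by rw [abs_of_pos hp]; exact hx)
  have h2 := hasProd_irred (Fq := Fq) (-x) (by rw [mul_neg, abs_neg, abs_of_pos hp]; exact hx)
  have h3 := hasProd_irred (Fq := Fq) (x ^ 2) (by
    rw [abs_of_pos (by positivity)]; nlinarith)
  have h12 := h1.mul h2
  have hn : (1 - (Fintype.card Fq : ℝ) * x) * (1 - (Fintype.card Fq : ℝ) * -x) ≠ 0 := by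
    apply ne_of_gt
    apply mul_pos <;> nlinarith
  have h : HasProd (fun P : {P : Polynomial Fq // P.Monic ∧ Irreducible P} =>
      (1 - (x ^ 2) ^ P.1.natDegree) / ((1 - x ^ P.1.natDegree) * (1 - (-x) ^ P.1.natDegree)))
      ((1 - (Fintype.card Fq : ℝ) * x ^ 2) /
        ((1 - (Fintype.card Fq : ℝ) * x) * (1 - (Fintype.card Fq : ℝ) * -x))) := by
    have := Filter.Tendsto.div h3 h12 hn
    refine this.congr fun S => ?_
    simp only [Finset.prod_div_distrib, Pi.div_apply]
  have hpow : ∀ P : {P : Polynomial Fq // P.Monic ∧ Irreducible P}, x ^ P.1.natDegree < 1 :=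
    fun P => pow_lt_one₀ hx0.le hx1 P.2.2.natDegree_pos.ne'
  have hs := (hasProd_subtype_iff_of_mulSupport_subset
    (s := {P : {P : Polynomial Fq // P.Monic ∧ Irreducible P} | Even P.1.natDegree}) (by
      intro P hP
      by_contra hodd
      have hodd' : Odd P.1.natDegree := Nat.not_even_iff_odd.mp hodd
      apply hP
      have := hpow P
      have : 0 < x ^ P.1.natDegree := by positivity
      have h4 : 1 - x ^ P.1.natDegree ≠ 0 := by linarith
      have h5 : 1 + x ^ P.1.natDegree ≠ 0 := by linarith
      simp only [hodd'.neg_pow, sub_neg_eq_add]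
      rw [div_eq_one_iff_eq (mul_ne_zero h4 h5), pow_right_comm x 2]
      ring)).mpr h
  let e : {P : Polynomial Fq // P.Monic ∧ Irreducible P ∧ Even P.natDegree} ≃
      ({P : {P : Polynomial Fq // P.Monic ∧ Irreducible P} | Even P.1.natDegree}) :=
    { toFun := fun P => ⟨⟨P.1, P.2.1, P.2.2.1⟩, P.2.2.2⟩
      invFun := fun P => ⟨P.1.1, P.1.2.1, P.1.2.2, P.2⟩
      left_inv := fun _ => rfl
      right_inv := fun _ => rfl }
  rw [← e.hasProd_iff] at hs
  convert hs using 1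
  · funext P
    have := hpow (e P).1
    have h0 : 0 < x ^ P.1.natDegree := by positivity
    have h4 : 1 - x ^ P.1.natDegree ≠ 0 := by
      have : x ^ P.1.natDegree < 1 := this
      linarith
    have hev : Even P.1.natDegree := P.2.2.2
    have he : (e P).1.1 = P.1 := rfl
    simp only [Function.comp, he]
    rw [hev.neg_pow, ← pow_mul, mul_comm 2, pow_mul]
    field_simp
    ring
  · rw [div_eq_inv_mul]
    congr 2
    ring

end Helpers

theorem stmt18 (Fq : Type*) [Field Fq] [Fintype Fq] (q : ℕ)
    (hq : Fintype.card Fq = q) :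
    (∀ s : ℝ, 1 < s →
        ∏' P : {P : Polynomial Fq // P.Monic ∧ Irreducible P ∧ Even P.natDegree},
            (1 + 2 * (q : ℝ) ^ (-(P.1.natDegree : ℝ) * s)) =
          (1 - (q : ℝ) ^ (2 * (1 - s)))⁻¹ * (1 - (q : ℝ) ^ (1 - 2 * s)) *
            ∏' P : {P : Polynomial Fq // P.Monic ∧ Irreducible P ∧ Even P.natDegree},
              ((q : ℝ) ^ ((P.1.natDegree : ℝ) * s) + 2) *
                  ((q : ℝ) ^ ((P.1.natDegree : ℝ) * s) - 1) /
                ((q : ℝ) ^ ((P.1.natDegree : ℝ) * s) *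
                  ((q : ℝ) ^ ((P.1.natDegree : ℝ) * s) + 1))) ∧
      ∀ s : ℝ, 1 / 2 < s →
        Multipliable
          (fun P : {P : Polynomial Fq // P.Monic ∧ Irreducible P ∧ Even P.natDegree} =>
            ((q : ℝ) ^ ((P.1.natDegree : ℝ) * s) + 2) *
                ((q : ℝ) ^ ((P.1.natDegree : ℝ) * s) - 1) /
              ((q : ℝ) ^ ((P.1.natDegree : ℝ) * s) *
                ((q : ℝ) ^ ((P.1.natDegree : ℝ) * s) + 1))) := by
  subst hq
  have hc : (1 : ℝ) < Fintype.card Fq := by exact_mod_cast Fintype.one_lt_card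
  have hc0 : (0 : ℝ) < Fintype.card Fq := by linarith
  set q : ℝ := (Fintype.card Fq : ℝ) with hqdef
  have hneg : ∀ (d : ℕ) (s : ℝ), q ^ (-(d : ℝ) * s) = (q ^ (-s)) ^ d := fun d s => by
    rw [← Real.rpow_natCast, ← Real.rpow_mul hc0.le]; congr 1; ring
  have hpos : ∀ (d : ℕ) (s : ℝ), q ^ ((d : ℝ) * s) = ((q ^ (-s)) ^ d)⁻¹ := fun d s => by
    rw [← hneg, ← Real.rpow_neg hc0.le]; congr 1; ring
  have hfac : ∀ u : ℝ, 0 < u → (u⁻¹ + 2) * (u⁻¹ - 1) / (u⁻¹ * (u⁻¹ + 1)) =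
      1 + (-2 * u ^ 2 / (1 + u)) := fun u hu => by
    have : u + 1 ≠ 0 := by linarith
    have : 1 + u ≠ 0 := by linarith
    field_simp
    ring
  have hmult : ∀ s : ℝ, 1 / 2 < s →
        Multipliable
          (fun P : {P : Polynomial Fq // P.Monic ∧ Irreducible P ∧ Even P.natDegree} =>
            (q ^ ((P.1.natDegree : ℝ) * s) + 2) *
                (q ^ ((P.1.natDegree : ℝ) * s) - 1) /
              (q ^ ((P.1.natDegree : ℝ) * s) *
                (q ^ ((P.1.natDegree : ℝ) * s) + 1))) := by
    intro s hs
    have hx0 : 0 < q ^ (-s) := by positivity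
    have hfun : (fun P : {P : Polynomial Fq // P.Monic ∧ Irreducible P ∧ Even P.natDegree} =>
            (q ^ ((P.1.natDegree : ℝ) * s) + 2) *
                (q ^ ((P.1.natDegree : ℝ) * s) - 1) /
              (q ^ ((P.1.natDegree : ℝ) * s) *
                (q ^ ((P.1.natDegree : ℝ) * s) + 1))) = fun P =>
          1 + (-2 * ((q ^ (-s)) ^ P.1.natDegree) ^ 2 / (1 + (q ^ (-s)) ^ P.1.natDegree)) := by
      funext P
      rw [hpos, hfac _ (by positivity)]
    rw [hfun]
    apply multipliable_one_add_of_summable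
    have hlt : |q * (q ^ (-s)) ^ 2| < 1 := by
      rw [abs_of_pos (by positivity)]
      have : q * (q ^ (-s)) ^ 2 = q ^ (1 - 2 * s) := by
        rw [← hneg]
        nth_rewrite 1 [← Real.rpow_one q]
        rw [← Real.rpow_add hc0]; congr 1; push_cast; ring
      rw [this]
      exact Real.rpow_lt_one_of_one_lt_of_neg hc (by linarith)
    have hsum := summable_monic (Fq := Fq) ((q ^ (-s)) ^ 2) hlt
    have hinj : Function.Injective
        (fun P : {P : Polynomial Fq // P.Monic ∧ Irreducible P ∧ Even P.natDegree} =>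
          (⟨P.1, P.2.1⟩ : {a : Polynomial Fq // a.Monic})) := by
      intro a b h
      exact Subtype.ext (congrArg (fun z => z.1) h)
    refine Summable.of_nonneg_of_le (fun _ => norm_nonneg _) (fun P => ?_)
      ((hsum.comp_injective hinj).mul_left 2)
    simp only [Function.comp]
    have hu : 0 < (q ^ (-s)) ^ P.1.natDegree := by positivity
    rw [abs_of_pos (by positivity : 0 < (q ^ (-s)) ^ 2),
      pow_right_comm (q ^ (-s)) 2 P.1.natDegree]
    set u := (q ^ (-s)) ^ P.1.natDegree
    rw [Real.norm_eq_abs, abs_div, abs_of_pos (by linarith : 0 < 1 + u), neg_mul, abs_neg,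
      abs_of_pos (by positivity)]
    exact div_le_self (by positivity) (by linarith)
  refine ⟨fun s hs => ?_, hmult⟩
  have hx0 : 0 < q ^ (-s) := by positivity
  have hx : q * q ^ (-s) < 1 := by
    nth_rewrite 1 [← Real.rpow_one q]
    rw [← Real.rpow_add hc0]
    exact Real.rpow_lt_one_of_one_lt_of_neg hc (by linarith)
  have hx1 : q ^ (-s) < 1 := by nlinarith
  have hE := hasProd_even (Fq := Fq) (q ^ (-s)) hx0 hx
  have hm := (hmult s (by linarith)).hasProd
  have hprod := (hE.mul hm).tprod_eq
  have e1 : q ^ (2 * (1 - s)) = q ^ 2 * (q ^ (-s)) ^ 2 := by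
    rw [← hneg, ← Real.rpow_natCast q 2, ← Real.rpow_add hc0]; congr 1; push_cast; ring
  have e2 : q ^ (1 - 2 * s) = q * (q ^ (-s)) ^ 2 := by
    rw [← hneg]
    nth_rewrite 2 [← Real.rpow_one q]
    rw [← Real.rpow_add hc0]; congr 1; push_cast; ring
  rw [e1, e2, ← hprod]
  refine tprod_congr fun P => ?_
  rw [hneg, hpos]
  have hu : 0 < (q ^ (-s)) ^ P.1.natDegree := by positivity
  have hu1 : (q ^ (-s)) ^ P.1.natDegree < 1 :=
    pow_lt_one₀ hx0.le hx1 P.2.2.1.natDegree_pos.ne'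
  rw [hfac _ hu]
  set u := (q ^ (-s)) ^ P.1.natDegree
  have : 1 - u ≠ 0 := by linarith
  have : 1 + u ≠ 0 := by linarith
  field_simp
  ring
end
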